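/- arXiv:2202.13993 — 8 statements merged into one kernel-verified Lean document; each statement's English description precedes it below -/
import Mathlib

section
/- Let g, d, d' be positive integers with d ≤ d', and let k ∈ ℕ^g with k_i ≥ 1 for all i. Then Γ(g, d', k) ⊆ Γ(g, d, k): every vector of noise parameters that renders all collections of g POVMs with k_i outcomes compatible in dimension d' also does so in dimension d. -/
open Matrix ComplexOrder

noncomputable section

/-- A `d`-dimensional POVM with `k` outcomes: positive semidefinite effects summing to `I`. -/
def IsPOVM {d k : ℕ} (E : Fin k → Matrix (Fin d) (Fin d) ℂ) : Prop :=
  (∀ j, (E j).PosSemidef) ∧ ∑ j, E j = 1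

/-- A collection of `g` POVMs (the `i`-th with `k i` outcomes) is compatible if they arise as
marginals of a joint POVM indexed by outcome tuples. -/
def CompatiblePOVMs {g d : ℕ} {k : Fin g → ℕ}
    (E : ∀ i, Fin (k i) → Matrix (Fin d) (Fin d) ℂ) : Prop :=
  ∃ R : (∀ i, Fin (k i)) → Matrix (Fin d) (Fin d) ℂ,
    (∀ t, (R t).PosSemidef) ∧ (∑ t, R t = 1) ∧
    ∀ (i : Fin g) (v : Fin (k i)),
      E i v = ∑ t ∈ Finset.univ.filter (fun t : ∀ i, Fin (k i) => t i = v), R t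

/-- The compatibility region `Γ(g, d, k)`: noise parameters `s ∈ [0,1]^g` such that the noisy
versions `s i • E i j + (1 - s i) I / k i` of any `g`-tuple of POVMs are compatible. -/
def Gamma (g d : ℕ) (k : Fin g → ℕ) : Set (Fin g → ℝ) :=
  {s | (∀ i, s i ∈ Set.Icc (0 : ℝ) 1) ∧
    ∀ E : ∀ i, Fin (k i) → Matrix (Fin d) (Fin d) ℂ,
      (∀ i, IsPOVM (E i)) →
      CompatiblePOVMs (fun i j => s i • E i j +
        ((1 - s i) * (k i : ℝ)⁻¹) • (1 : Matrix (Fin d) (Fin d) ℂ))}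

/-- Compressing a compatible family by an isometry yields a compatible family. -/
theorem CompatiblePOVMs.conjTranspose_mul_mul {g d d' : ℕ} {k : Fin g → ℕ}
    {E : ∀ i, Fin (k i) → Matrix (Fin d') (Fin d') ℂ} (hE : CompatiblePOVMs E)
    {V : Matrix (Fin d') (Fin d) ℂ} (hV : Vᴴ * V = 1) :
    CompatiblePOVMs (fun i j => Vᴴ * E i j * V) := by
  obtain ⟨R, hR, hsum, hmarg⟩ := hE
  refine ⟨fun t => Vᴴ * R t * V, fun t => (hR t).conjTranspose_mul_mul_same V, ?_, fun i v => ?_⟩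
  · rw [← Matrix.sum_mul, ← Matrix.mul_sum, hsum, Matrix.mul_one, hV]
  · simp only [hmarg, Matrix.sum_mul, Matrix.mul_sum]

/-- The complement of the range projection of an isometry is positive semidefinite. -/
theorem posSemidef_one_sub_mul_conjTranspose {d d' : ℕ} {V : Matrix (Fin d') (Fin d) ℂ}
    (hV : Vᴴ * V = 1) : (1 - V * Vᴴ).PosSemidef := by
  have hP : (1 - V * Vᴴ)ᴴ * (1 - V * Vᴴ) = 1 - V * Vᴴ := by
    have hidem : V * Vᴴ * (V * Vᴴ) = V * Vᴴ := by
      rw [Matrix.mul_assoc, ← Matrix.mul_assoc Vᴴ, hV, Matrix.one_mul]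
    simp [Matrix.mul_sub, Matrix.sub_mul, hidem]
  exact hP ▸ posSemidef_conjTranspose_mul_self (1 - V * Vᴴ)

/-- A POVM extends along an isometry by distributing the complementary projection uniformly
over the outcomes. -/
theorem IsPOVM.extend {d d' k : ℕ} {E : Fin k → Matrix (Fin d) (Fin d) ℂ} (hE : IsPOVM E)
    (hk : k ≠ 0) {V : Matrix (Fin d') (Fin d) ℂ} (hV : Vᴴ * V = 1) :
    IsPOVM (fun j => V * E j * Vᴴ + (k : ℂ)⁻¹ • (1 - V * Vᴴ)) := by
  refine ⟨fun j => ((hE.1 j).mul_mul_conjTranspose_same V).add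
    ((posSemidef_one_sub_mul_conjTranspose hV).smul (by positivity)), ?_⟩
  rw [Finset.sum_add_distrib, ← Matrix.sum_mul, ← Matrix.mul_sum, hE.2, Finset.sum_const,
    Finset.card_univ, Fintype.card_fin, ← Nat.cast_smul_eq_nsmul ℂ, smul_smul,
    mul_inv_cancel₀ (Nat.cast_ne_zero.mpr hk), one_smul, Matrix.mul_one, add_sub_cancel]

/-- The extension of an effect along an isometry compresses back to the effect. -/
theorem conjTranspose_mul_extend_mul {d d' : ℕ} {V : Matrix (Fin d') (Fin d) ℂ}
    (hV : Vᴴ * V = 1) (A : Matrix (Fin d) (Fin d) ℂ) (c : ℂ) :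
    Vᴴ * (V * A * Vᴴ + c • (1 - V * Vᴴ)) * V = A := by
  have hA : Vᴴ * (V * A * Vᴴ) * V = A := by
    rw [Matrix.mul_assoc V, ← Matrix.mul_assoc Vᴴ, hV, Matrix.one_mul, Matrix.mul_assoc, hV,
      Matrix.mul_one]
  have hP : (1 - V * Vᴴ) * V = 0 := by
    rw [Matrix.sub_mul, Matrix.mul_assoc, hV, Matrix.one_mul, Matrix.mul_one, sub_self]
  rw [Matrix.mul_add, Matrix.add_mul, hA, Matrix.mul_assoc, Matrix.smul_mul, hP, smul_zero,
    Matrix.mul_zero, add_zero]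

/-- For `d ≤ d'` there is an isometry from dimension `d` to dimension `d'`. -/
theorem exists_conjTranspose_mul_self_eq_one {d d' : ℕ} (h : d ≤ d') :
    ∃ V : Matrix (Fin d') (Fin d) ℂ, Vᴴ * V = 1 := by
  refine ⟨(1 : Matrix (Fin d') (Fin d') ℂ).submatrix id (Fin.castLE h), ?_⟩
  rw [conjTranspose_submatrix, conjTranspose_one,
    submatrix_mul _ _ _ id _ Function.bijective_id |>.symm, Matrix.one_mul]
  exact submatrix_one _ (Fin.castLE_injective h)

/-- For `d ≤ d'`, `Γ(g, d', k) ⊆ Γ(g, d, k)`. -/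
theorem gamma_antitone_dim (g d d' : ℕ) (hg : 0 < g) (hd : 0 < d) (hdd' : d ≤ d')
    (k : Fin g → ℕ) (hk : ∀ i, 1 ≤ k i) :
    Gamma g d' k ⊆ Gamma g d k := by
  obtain ⟨V, hV⟩ := exists_conjTranspose_mul_self_eq_one hdd'
  intro s hs
  refine ⟨hs.1, fun E hE => ?_⟩
  have hcomp := (hs.2 _ fun i =>
    (hE i).extend (Nat.one_le_iff_ne_zero.mp (hk i)) hV).conjTranspose_mul_mul hV
  convert hcomp using 3 with i j
  rw [Matrix.mul_add, Matrix.add_mul, Matrix.mul_smul, Matrix.smul_mul,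
    conjTranspose_mul_extend_mul hV, Matrix.mul_smul, Matrix.smul_mul, Matrix.mul_one, hV]
end
end

section
/- Let g, d be positive integers and let k, k' ∈ ℕ^g with 1 ≤ k_i ≤ k'_i for all i ∈ [g]. Then Γ(g, d, k') ⊆ Γ(g, d, k). -/
open Matrix ComplexOrder

noncomputable section

/-- Summing a product of weights, each of total mass one, over the tuples with a prescribed `i`-th
entry leaves the weight of that entry. -/
theorem sum_filter_prod_eq {ι : Type*} [Fintype ι] [DecidableEq ι] {α : ι → Type*}
    [∀ i, Fintype (α i)] [∀ i, DecidableEq (α i)] (p : ∀ i, α i → ℝ)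
    (hp : ∀ i, ∑ x, p i x = 1) (i : ι) (a : α i) :
    ∑ t ∈ Finset.univ.filter (fun t : ∀ i, α i => t i = a), ∏ l, p l (t l) = p i a := by
  have h := Fintype.piFinset_update_singleton_eq_filter_piFinset_eq
    (fun l => (Finset.univ : Finset (α l))) i (Finset.mem_univ a)
  rw [Fintype.piFinset_univ] at h
  rw [← h, ← Finset.prod_univ_sum, Finset.prod_eq_single i]
  · simp
  · intro l _ hl
    rw [Function.update_of_ne hl, hp]
  · simp

/-- Compatibility is preserved under classical post-processing of the individual POVMs. -/
theorem CompatiblePOVMs.postprocess {g d : ℕ} {k k' : Fin g → ℕ}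
    {F : ∀ i, Fin (k' i) → Matrix (Fin d) (Fin d) ℂ} (hF : CompatiblePOVMs F)
    (p : ∀ i, Fin (k' i) → Fin (k i) → ℝ) (hp0 : ∀ i v j, 0 ≤ p i v j)
    (hp1 : ∀ i v, ∑ j, p i v j = 1) :
    CompatiblePOVMs (fun i j => ∑ v, p i v j • F i v) := by
  obtain ⟨R, hR, hR1, hRF⟩ := hF
  refine ⟨fun t => ∑ u, (∏ i, p i (u i) (t i)) • R u, fun t => ?_, ?_, fun i j => ?_⟩
  · exact Matrix.posSemidef_sum _ fun u _ =>
      (hR u).smul (Finset.prod_nonneg fun i _ => hp0 i (u i) (t i))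
  · rw [Finset.sum_comm, ← hR1]
    refine Finset.sum_congr rfl fun u _ => ?_
    rw [← Finset.sum_smul, ← Fintype.prod_sum]
    simp [hp1]
  · rw [Finset.sum_comm]
    simp_rw [← Finset.sum_smul]
    rw [← Finset.sum_fiberwise Finset.univ (fun u : ∀ i, Fin (k' i) => u i)]
    refine Finset.sum_congr rfl fun v _ => ?_
    rw [hRF, Finset.smul_sum]
    refine Finset.sum_congr rfl fun u hu => ?_
    rw [sum_filter_prod_eq (fun l => p l (u l)) (fun l => hp1 l (u l)), (Finset.mem_filter.mp hu).2]

/-- Extension of a family of effects by zero along a map of outcome sets. -/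
def extendEffects {d k k' : ℕ} (f : Fin k → Fin k') (E : Fin k → Matrix (Fin d) (Fin d) ℂ)
    (v : Fin k') : Matrix (Fin d) (Fin d) ℂ :=
  ∑ j, if f j = v then E j else 0

theorem IsPOVM.extendEffects {d k k' : ℕ} (f : Fin k → Fin k')
    {E : Fin k → Matrix (Fin d) (Fin d) ℂ} (hE : IsPOVM E) : IsPOVM (extendEffects f E) := by
  refine ⟨fun v => Matrix.posSemidef_sum _ fun j _ => ?_, ?_⟩
  · split_ifs
    exacts [hE.1 j, Matrix.PosSemidef.zero]
  · simp only [_root_.extendEffects]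
    rw [Finset.sum_comm]
    simpa using hE.2

/-- The number of preimages of `v` under `f`, as a real number. -/
def fiberCount {k k' : ℕ} (f : Fin k → Fin k') (v : Fin k') : ℝ :=
  ∑ l, if f l = v then 1 else 0

theorem fiberCount_le_one {k k' : ℕ} {f : Fin k → Fin k'} (hf : Function.Injective f)
    (v : Fin k') : fiberCount f v ≤ 1 := by
  rw [fiberCount, Finset.sum_boole]
  norm_cast
  rw [Finset.card_le_one]
  simp only [Finset.mem_filter, Finset.mem_univ, true_and]
  exact fun a ha b hb => hf (ha.trans hb.symm)

theorem fiberCount_apply {k k' : ℕ} {f : Fin k → Fin k'} (hf : Function.Injective f)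
    (l : Fin k) : fiberCount f (f l) = 1 := by
  simp [fiberCount, hf.eq_iff]

theorem sum_fiberCount {k k' : ℕ} (f : Fin k → Fin k') : ∑ v, fiberCount f v = k := by
  simp only [fiberCount]
  rw [Finset.sum_comm]
  simp

/-- The Markov kernel inverting `f` on its range and choosing a uniformly random outcome off it. -/
def retractKernel {k k' : ℕ} (f : Fin k → Fin k') (v : Fin k') (j : Fin k) : ℝ :=
  (if f j = v then 1 else 0) + (k : ℝ)⁻¹ * (1 - fiberCount f v)

theorem retractKernel_nonneg {k k' : ℕ} {f : Fin k → Fin k'} (hf : Function.Injective f)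
    (v : Fin k') (j : Fin k) : 0 ≤ retractKernel f v j := by
  have h := sub_nonneg.mpr (fiberCount_le_one hf v)
  unfold retractKernel
  split_ifs <;> positivity

theorem sum_retractKernel {k k' : ℕ} (f : Fin k → Fin k') (hk : k ≠ 0) (v : Fin k') :
    ∑ j, retractKernel f v j = 1 := by
  have hk' : (k : ℝ) ≠ 0 := Nat.cast_ne_zero.mpr hk
  simp only [retractKernel, Finset.sum_add_distrib]
  rw [← fiberCount, Finset.sum_const, Finset.card_univ, Fintype.card_fin, nsmul_eq_mul]
  field_simp
  ring

theorem retractKernel_apply {k k' : ℕ} {f : Fin k → Fin k'} (hf : Function.Injective f)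
    (l j : Fin k) : retractKernel f (f l) j = if j = l then 1 else 0 := by
  simp [retractKernel, fiberCount_apply hf, hf.eq_iff]

theorem sum_retractKernel_left {k k' : ℕ} (f : Fin k → Fin k') (hk : k ≠ 0) (j : Fin k) :
    ∑ v, retractKernel f v j = k' * (k : ℝ)⁻¹ := by
  have hk' : (k : ℝ) ≠ 0 := Nat.cast_ne_zero.mpr hk
  simp only [retractKernel, Finset.sum_add_distrib]
  rw [← Finset.mul_sum, Finset.sum_sub_distrib, sum_fiberCount]
  simp
  field_simp
  ring

theorem sum_retractKernel_smul_extendEffects {d k k' : ℕ} {f : Fin k → Fin k'}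
    (hf : Function.Injective f) (E : Fin k → Matrix (Fin d) (Fin d) ℂ) (j : Fin k) :
    ∑ v, retractKernel f v j • extendEffects f E v = E j := by
  simp only [extendEffects, Finset.smul_sum, smul_ite, smul_zero]
  rw [Finset.sum_comm]
  simp [retractKernel_apply hf]

/-- For `k ≤ k'` pointwise, `Γ(g, d, k') ⊆ Γ(g, d, k)`. -/
theorem gamma_antitone_outcomes (g d : ℕ) (hg : 0 < g) (hd : 0 < d)
    (k k' : Fin g → ℕ) (hk : ∀ i, 1 ≤ k i) (hkk' : ∀ i, k i ≤ k' i) :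
    Gamma g d k' ⊆ Gamma g d k := by
  rintro s ⟨hs, hcompat⟩
  refine ⟨hs, fun E hE => ?_⟩
  have hk0 : ∀ i, k i ≠ 0 := fun i => Nat.one_le_iff_ne_zero.mp (hk i)
  have hf : ∀ i, Function.Injective (Fin.castLE (hkk' i)) := fun i => Fin.castLE_injective _
  have h := (hcompat (fun i => extendEffects (Fin.castLE (hkk' i)) (E i))
    (fun i => (hE i).extendEffects _)).postprocess
    (fun i => retractKernel (Fin.castLE (hkk' i))) (fun i => retractKernel_nonneg (hf i))
    (fun i => sum_retractKernel _ (hk0 i))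
  convert h using 3 with i j
  have hk'0 : (k' i : ℝ) ≠ 0 :=
    Nat.cast_ne_zero.mpr (Nat.one_le_iff_ne_zero.mp ((hk i).trans (hkk' i)))
  simp_rw [smul_add, Finset.sum_add_distrib, smul_comm _ (s i)]
  rw [← Finset.smul_sum, sum_retractKernel_smul_extendEffects (hf i), ← Finset.sum_smul,
    sum_retractKernel_left _ (hk0 i), smul_smul]
  congr 2
  field_simp
end
end

section
/- Let g, d be positive integers and k ∈ ℕ^g with k_i ≥ 1 for all i. Then the simplex {s ∈ [0,1]^g : s_1 + … + s_g ≤ 1} is contained in the compatibility region Γ(g, d, k). -/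
open Matrix ComplexOrder

noncomputable section

/-- Summing a function of the `m`-th coordinate over a product of finite sets. -/
lemma sum_piFinset_apply_coord {ι M : Type*} [Fintype ι] [DecidableEq ι] {α : ι → Type*}
    [∀ i, DecidableEq (α i)] [AddCommGroup M] [Module ℝ M] (S : ∀ i, Finset (α i)) (m : ι)
    (f : α m → M) (hS : (S m).Nonempty) :
    ∑ t ∈ Fintype.piFinset S, f (t m) =
      ((Fintype.piFinset S).card : ℝ) • ((S m).card : ℝ)⁻¹ • ∑ w ∈ S m, f w := by
  have hm : ((S m).card : ℝ) ≠ 0 := by exact_mod_cast hS.card_pos.ne'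
  have hcard : ((Fintype.piFinset S).card : ℝ) * ((S m).card : ℝ)⁻¹ =
      ∏ b ∈ Finset.univ.erase m, ((S b).card : ℝ) := by
    rw [Fintype.card_piFinset, ← Finset.mul_prod_erase _ _ (Finset.mem_univ m)]
    push_cast
    field_simp
  rw [← Finset.sum_fiberwise_of_maps_to (g := fun t => t m) (t := S m)
    (fun t ht => Fintype.mem_piFinset.mp ht m), smul_smul, hcard, Finset.smul_sum]
  refine Finset.sum_congr rfl fun w hw => ?_
  rw [Finset.sum_congr rfl (g := fun _ => f w) (by
      intro t ht
      rw [(Finset.mem_filter.mp ht).2]), Finset.sum_const,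
    Fintype.card_filter_piFinset_eq_of_mem _ _ hw, ← Nat.cast_smul_eq_nsmul ℝ, Nat.cast_prod]

/-- The joint measurement that performs the `m`-th POVM with probability `s m` and guesses all
other outcomes uniformly at random. -/
def randomizedJoint {g d : ℕ} {k : Fin g → ℕ} (s : Fin g → ℝ)
    (E : ∀ i, Fin (k i) → Matrix (Fin d) (Fin d) ℂ) (t : ∀ i, Fin (k i)) :
    Matrix (Fin d) (Fin d) ℂ :=
  (∏ i, (k i : ℝ))⁻¹ • ((1 - ∑ m, s m) • 1 + ∑ m, (s m * k m) • E m (t m))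

lemma sum_piFinset_randomizedJoint {g d : ℕ} {k : Fin g → ℕ} (s : Fin g → ℝ)
    (E : ∀ i, Fin (k i) → Matrix (Fin d) (Fin d) ℂ) (S : ∀ i, Finset (Fin (k i)))
    (hS : ∀ i, (S i).Nonempty) :
    ∑ t ∈ Fintype.piFinset S, randomizedJoint s E t =
      ((∏ i, (k i : ℝ))⁻¹ * ∏ i, ((S i).card : ℝ)) •
        ((1 - ∑ m, s m) • 1 + ∑ m, (s m * k m * ((S m).card : ℝ)⁻¹) • ∑ w ∈ S m, E m w) := by
  simp only [randomizedJoint]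
  rw [← Finset.smul_sum, Finset.sum_add_distrib, Finset.sum_const, Finset.sum_comm, mul_smul]
  congr 1
  rw [smul_add, ← Nat.cast_smul_eq_nsmul ℝ, Fintype.card_piFinset, Nat.cast_prod,
    Finset.smul_sum]
  congr 1
  refine Finset.sum_congr rfl fun m _ => ?_
  rw [← Finset.smul_sum, sum_piFinset_apply_coord S m (E m) (hS m), Fintype.card_piFinset,
    Nat.cast_prod]
  simp only [smul_smul]
  congr 1
  ring

/-- The simplex `{s ∈ [0,1]^g : ∑ s i ≤ 1}` is contained in `Γ(g, d, k)`. -/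
theorem simplex_subset_gamma (g d : ℕ) (hg : 0 < g) (hd : 0 < d)
    (k : Fin g → ℕ) (hk : ∀ i, 1 ≤ k i) :
    {s : Fin g → ℝ | (∀ i, s i ∈ Set.Icc (0 : ℝ) 1) ∧ ∑ i, s i ≤ 1} ⊆ Gamma g d k := by
  rintro s ⟨hs, hsum⟩
  refine ⟨hs, fun E hE => ⟨randomizedJoint s E, fun t => ?_, ?_, fun i v => ?_⟩⟩
  · refine Matrix.PosSemidef.smul (.add (.smul .one (sub_nonneg.mpr hsum)) ?_) (by positivity)
    exact Matrix.posSemidef_sum _ fun m _ =>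
      ((hE m).1 _).smul (mul_nonneg (hs m).1 (Nat.cast_nonneg _))
  all_goals
    have hk0 : ∀ i, (k i : ℝ) ≠ 0 := fun i => by exact_mod_cast (Nat.one_le_iff_ne_zero.mp (hk i))
    have hne : ∀ i, (Finset.univ : Finset (Fin (k i))).Nonempty := fun i => ⟨⟨0, hk i⟩, by simp⟩
  · have h := sum_piFinset_randomizedJoint s E (fun _ => Finset.univ) hne
    rw [Fintype.piFinset_univ] at h
    rw [h]
    simp only [Finset.card_univ, Fintype.card_fin, (hE _).2, mul_inv_cancel_right₀ (hk0 _)]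
    rw [inv_mul_cancel₀ (Finset.prod_ne_zero_iff.mpr fun i _ => hk0 i), one_smul,
      ← Finset.sum_smul, ← add_smul, sub_add_cancel, one_smul]
  · let S : ∀ i, Finset (Fin (k i)) := Function.update (fun _ => Finset.univ) i {v}
    have hSi : S i = {v} := Function.update_self ..
    have hSm : ∀ m, m ≠ i → S m = Finset.univ := fun m hm => Function.update_of_ne hm ..
    have hS : ∀ m, (S m).Nonempty := fun m => by
      by_cases hm : m = i
      · subst hm; simp [hSi]
      · rw [hSm m hm]; exact hne m
    have hfilter : Finset.univ.filter (fun t : ∀ i, Fin (k i) => t i = v) =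
        Fintype.piFinset S := by
      ext t
      simp only [Finset.mem_filter, Finset.mem_univ, true_and, Fintype.mem_piFinset]
      refine ⟨fun ht m => ?_, fun h => by simpa [hSi] using h i⟩
      by_cases hm : m = i
      · subst hm; simp [hSi, ht]
      · simp [hSm m hm]
    have hprod : (∏ m, (k m : ℝ))⁻¹ * ∏ m, ((S m).card : ℝ) = (k i : ℝ)⁻¹ := by
      have hrest : ∏ m ∈ Finset.univ.erase i, ((S m).card : ℝ) =
          ∏ m ∈ Finset.univ.erase i, (k m : ℝ) :=
        Finset.prod_congr rfl fun m hm => by simp [hSm m (Finset.ne_of_mem_erase hm)]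
      have hrest0 : ∏ m ∈ Finset.univ.erase i, (k m : ℝ) ≠ 0 :=
        Finset.prod_ne_zero_iff.mpr fun m _ => hk0 m
      rw [← Finset.mul_prod_erase _ _ (Finset.mem_univ i),
        ← Finset.mul_prod_erase _ (fun m => ((S m).card : ℝ)) (Finset.mem_univ i), hrest, hSi]
      have := hk0 i
      simp only [Finset.card_singleton, Nat.cast_one]
      field_simp
    have hterms : ∑ m ∈ Finset.univ.erase i,
        (s m * k m * ((S m).card : ℝ)⁻¹) • ∑ w ∈ S m, E m w =
        (∑ m ∈ Finset.univ.erase i, s m) • (1 : Matrix (Fin d) (Fin d) ℂ) := by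
      rw [Finset.sum_smul]
      refine Finset.sum_congr rfl fun m hm => ?_
      rw [hSm m (Finset.ne_of_mem_erase hm), (hE m).2, Finset.card_univ, Fintype.card_fin,
        mul_inv_cancel_right₀ (hk0 m)]
    rw [hfilter, sum_piFinset_randomizedJoint s E S hS, hprod,
      ← Finset.add_sum_erase _ s (Finset.mem_univ i),
      ← Finset.add_sum_erase _ (fun m => (s m * k m * ((S m).card : ℝ)⁻¹) • ∑ w ∈ S m, E m w)
        (Finset.mem_univ i), hterms, hSi]
    simp only [Finset.card_singleton, Finset.sum_singleton, Nat.cast_one, inv_one, mul_one]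
    have := hk0 i
    match_scalars <;> field_simp
    ring
end
end

section
/- For every integer d ≥ 2, the compatibility region for two dichotomic measurements satisfies Γ(2, d) = {s ∈ [0,1]^2 : s_1^2 + s_2^2 ≤ 1}. -/
open Matrix ComplexOrder

noncomputable section

/-- A sum over pairs of bits, written out. -/
lemma sum_fin_two_arrow {M : Type*} [AddCommMonoid M] (f : (Fin 2 → Fin 2) → M) :
    ∑ t, f t = f ![0, 0] + f ![0, 1] + (f ![1, 0] + f ![1, 1]) := by
  rw [← (finTwoArrowEquiv (Fin 2)).symm.sum_comp, Fintype.sum_prod_type]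
  simp [finTwoArrowEquiv]

/-- A Hermitian projection and its complement form a dichotomic POVM. -/
lemma isPOVM_of_projection {d : ℕ} {P : Matrix (Fin d) (Fin d) ℂ} (hP : P.IsHermitian)
    (hPP : P * P = P) : IsPOVM ![P, 1 - P] := by
  refine ⟨?_, by simp⟩
  have key : ∀ Q : Matrix (Fin d) (Fin d) ℂ, Q.IsHermitian → Q * Q = Q → Q.PosSemidef := by
    intro Q hQ hQQ
    have h := Matrix.posSemidef_conjTranspose_mul_self Q
    rwa [hQ.eq, hQQ] at h
  rw [Fin.forall_fin_two]
  refine ⟨key P hP hPP, key (1 - P) (Matrix.isHermitian_one.sub hP) ?_⟩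
  simp [mul_sub, sub_mul, hPP]

/-- The observable `E₀ - E₁` of a dichotomic POVM is a contraction. -/
lemma IsPOVM.one_sub_sq_posSemidef {d : ℕ} {E : Fin 2 → Matrix (Fin d) (Fin d) ℂ}
    (hE : IsPOVM E) : (1 - (E 0 - E 1) * (E 0 - E 1)).PosSemidef := by
  obtain ⟨hpos, hsum⟩ := hE
  rw [Fin.sum_univ_two] at hsum
  have h1 : E 1 = 1 - E 0 := eq_sub_of_add_eq' hsum
  have hp := (hpos 1).conjTranspose_mul_mul_same (E 0)
  have hq := (hpos 0).conjTranspose_mul_mul_same (E 1)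
  rw [(hpos 0).isHermitian.eq] at hp
  rw [(hpos 1).isHermitian.eq] at hq
  have h := (hp.add hq).smul (show (0 : ℝ) ≤ 4 by norm_num)
  convert h using 1
  rw [h1]
  simp only [mul_sub, sub_mul, mul_one, one_mul, smul_add, smul_sub, mul_assoc]
  module

/-- The effects `(1/4) (1 + a A + b B + ab (AB + BA) / 2)` are positive for contractions `A, B`
whenever `a² + b² ≤ 1`. -/
lemma posSemidef_joint_effect {d : ℕ} {A B : Matrix (Fin d) (Fin d) ℂ} (hA : A.IsHermitian)
    (hB : B.IsHermitian) (hA1 : (1 - A * A).PosSemidef) (hB1 : (1 - B * B).PosSemidef)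
    {a b : ℝ} (hab : a ^ 2 + b ^ 2 ≤ 1) :
    ((1 / 4 : ℝ) • (1 + a • A + b • B + (a * b / 2) • (A * B + B * A))).PosSemidef := by
  have hX : (1 + a • A + b • B).IsHermitian := by
    simp [Matrix.IsHermitian, hA.eq, hB.eq]
  have h := Matrix.posSemidef_conjTranspose_mul_self (1 + a • A + b • B)
  rw [hX.eq] at h
  have h' := (((h.add (hA1.smul (sq_nonneg a))).add (hB1.smul (sq_nonneg b))).add
    (Matrix.PosSemidef.one.smul (sub_nonneg.2 hab))).smul (show (0 : ℝ) ≤ 1 / 8 by norm_num)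
  convert h' using 1
  simp only [mul_add, add_mul, mul_one, one_mul, Matrix.smul_mul, Matrix.mul_smul]
  module

/-- Two dichotomic POVMs with noise parameters in the unit disc are compatible. -/
lemma compatiblePOVMs_of_sq_add_sq_le {d : ℕ} {s : Fin 2 → ℝ} (hs : s 0 ^ 2 + s 1 ^ 2 ≤ 1)
    (E : Fin 2 → Fin 2 → Matrix (Fin d) (Fin d) ℂ) (hE : ∀ i, IsPOVM (E i)) :
    CompatiblePOVMs (k := fun _ : Fin 2 => 2) (fun i j => s i • E i j +
        ((1 - s i) * ((2 : ℕ) : ℝ)⁻¹) • (1 : Matrix (Fin d) (Fin d) ℂ)) := by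
  let A : Fin 2 → Matrix (Fin d) (Fin d) ℂ := fun i => E i 0 - E i 1
  have hA : ∀ i, (A i).IsHermitian := fun i =>
    ((hE i).1 0).isHermitian.sub ((hE i).1 1).isHermitian
  have hA1 : ∀ i, (1 - A i * A i).PosSemidef := fun i => (hE i).one_sub_sq_posSemidef
  let sg : Fin 2 → ℝ := ![1, -1]
  have hsg : ∀ j, sg j ^ 2 = 1 := by
    intro j; fin_cases j <;> simp [sg]
  have hsum : ∀ i, E i 1 = 1 - E i 0 := by
    intro i
    have h := (hE i).2
    rw [Fin.sum_univ_two] at h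
    exact eq_sub_of_add_eq' h
  refine ⟨fun t => (1 / 4 : ℝ) • (1 + (sg (t 0) * s 0) • A 0 + (sg (t 1) * s 1) • A 1 +
    (sg (t 0) * s 0 * (sg (t 1) * s 1) / 2) • (A 0 * A 1 + A 1 * A 0)), ?_, ?_, ?_⟩
  · intro t
    refine posSemidef_joint_effect (hA 0) (hA 1) (hA1 0) (hA1 1) ?_
    rw [mul_pow, mul_pow, hsg, hsg]
    simpa using hs
  · rw [sum_fin_two_arrow]
    simp [sg]
    module
  · intro i v
    rw [Finset.sum_filter, sum_fin_two_arrow]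
    fin_cases i <;> fin_cases v <;> simp [sg, A, hsum] <;> module

/-- The corner of a positive semidefinite matrix on two coordinates, tested against a real
traceless symmetric matrix of norm `√(x² + y²)`. -/
lemma posSemidef_corner_le {n : Type*} {M : Matrix n n ℂ} (hM : M.PosSemidef) (i j : n)
    (x y : ℝ) :
    x * (2 * (M i j).re) + y * ((M i i).re - (M j j).re) ≤
      √(x ^ 2 + y ^ 2) * ((M i i).re + (M j j).re) := by
  have h2 := hM.submatrix ![i, j]
  have ha : 0 ≤ (M i i).re := (Complex.le_def.1 (h2.diag_nonneg (i := 0))).1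
  have hc : 0 ≤ (M j j).re := (Complex.le_def.1 (h2.diag_nonneg (i := 1))).1
  have haim : (M i i).im = 0 := ((Complex.le_def.1 (h2.diag_nonneg (i := 0))).2).symm
  have hji : M j i = star (M i j) := (hM.isHermitian.apply j i).symm
  have hdet := (Complex.le_def.1 h2.det_nonneg).1
  rw [Matrix.det_fin_two] at hdet
  simp [hji, haim] at hdet
  refine le_of_sq_le_sq ?_ (by positivity)
  rw [mul_pow, Real.sq_sqrt (by positivity)]
  nlinarith [sq_nonneg (x * ((M i i).re - (M j j).re) - y * (2 * (M i j).re)),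
    mul_nonneg (add_nonneg (sq_nonneg x) (sq_nonneg y)) (sub_nonneg.2 hdet),
    mul_nonneg (add_nonneg (sq_nonneg x) (sq_nonneg y)) (sq_nonneg (M i j).im)]

/-- Noise parameters in the compatibility region of two dichotomic POVMs lie in the unit disc. -/
lemma sq_add_sq_le_of_mem_Gamma {d : ℕ} (hd : 2 ≤ d) {s : Fin 2 → ℝ}
    (hs : s ∈ Gamma 2 d (fun _ => 2)) : s 0 ^ 2 + s 1 ^ 2 ≤ 1 := by
  let i : Fin d := ⟨0, by omega⟩
  let j : Fin d := ⟨1, by omega⟩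
  have hij : i ≠ j := by simp [i, j]
  let v : Fin d → ℂ := Pi.single i 1 + Pi.single j 1
  let P : Matrix (Fin d) (Fin d) ℂ := (1 / 2 : ℂ) • Matrix.vecMulVec v v
  let Q : Matrix (Fin d) (Fin d) ℂ := Matrix.single i i 1
  have hvv : v ⬝ᵥ v = 2 := by
    simp [v, hij, hij.symm]
    norm_num
  have hv : star v = v := by
    simp [v]
  have hP : IsPOVM ![P, 1 - P] := by
    refine isPOVM_of_projection ?_ ?_
    · simp [P, Matrix.IsHermitian, Matrix.conjTranspose_vecMulVec, hv]
    · simp [P, Matrix.vecMulVec_mul_vecMulVec, hvv, smul_smul]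
  have hQ : IsPOVM ![Q, 1 - Q] := by
    refine isPOVM_of_projection ?_ ?_
    · simp [Q, Matrix.IsHermitian]
    · simp [Q]
  obtain ⟨R, hR, -, hm⟩ := hs.2 ![![P, 1 - P], ![Q, 1 - Q]] (by
    rw [Fin.forall_fin_two]
    exact ⟨hP, hQ⟩)
  have hm' : ∀ l w : Fin 2, _ := hm
  simp only [Finset.sum_filter, sum_fin_two_arrow] at hm'
  have hPij : P i j = 1 / 2 := by simp [P, v, Matrix.vecMulVec_apply, hij, hij.symm]
  have hd0 : ∀ w k l, _ := fun w k l => congrArg Complex.re (congrFun (congrFun (hm' 0 w) k) l)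
  have hd1 : ∀ w k l, _ := fun w k l => congrArg Complex.re (congrFun (congrFun (hm' 1 w) k) l)
  have e1 := hd0 0 i j
  have e2 := hd0 1 i j
  have f1 := hd1 0 i i
  have f2 := hd1 1 i i
  have f3 := hd1 0 j j
  have f4 := hd1 1 j j
  simp [hPij, hij, Q] at e1 e2 f1 f2 f3 f4
  have k00 := posSemidef_corner_le (hR ![0, 0]) i j (s 0) (s 1)
  have k01 := posSemidef_corner_le (hR ![0, 1]) i j (s 0) (-s 1)
  have k10 := posSemidef_corner_le (hR ![1, 0]) i j (-s 0) (s 1)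
  have k11 := posSemidef_corner_le (hR ![1, 1]) i j (-s 0) (-s 1)
  simp only [neg_sq] at k01 k10 k11
  have hr0 := Real.sqrt_nonneg (s 0 ^ 2 + s 1 ^ 2)
  have hr2 := Real.sq_sqrt (add_nonneg (sq_nonneg (s 0)) (sq_nonneg (s 1)))
  set r := √(s 0 ^ 2 + s 1 ^ 2)
  have hle : s 0 ^ 2 + s 1 ^ 2 ≤ r := by
    linear_combination (k00 + k01 + k10 + k11) / 2 + s 0 * (e1 - e2) +
      s 1 / 2 * (f1 - f2 - f3 + f4) - r / 2 * (f1 + f2 + f3 + f4)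
  nlinarith

/-- For `d ≥ 2`, `Γ(2, d) = {s ∈ [0,1]^2 : s₁² + s₂² ≤ 1}`. -/
theorem gamma_two_dichotomic (d : ℕ) (hd : 2 ≤ d) :
    Gamma 2 d (fun _ => 2) =
      {s : Fin 2 → ℝ | (∀ i, s i ∈ Set.Icc (0 : ℝ) 1) ∧ s 0 ^ 2 + s 1 ^ 2 ≤ 1} := by
  ext s
  refine ⟨fun hs => ⟨hs.1, sq_add_sq_le_of_mem_Gamma hd hs⟩, fun hs => ⟨hs.1, fun E hE => ?_⟩⟩
  exact compatiblePOVMs_of_sq_add_sq_le hs.2 E hE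
end
end

section
/- The compatibility region for three dichotomic qubit measurements satisfies Γ(3, 2) = {s ∈ [0,1]^3 : s_1^2 + s_2^2 + s_3^2 ≤ 1}. -/
open Matrix ComplexOrder

noncomputable section

theorem sum_fin_three_fin_two {M : Type*} [AddCommMonoid M] (f : (Fin 3 → Fin 2) → M) :
    ∑ t, f t = ∑ a, ∑ b, ∑ c, f ![a, b, c] := by
  simp only [← Fintype.sum_prod_type']
  let e : (Fin 3 → Fin 2) ≃ (Fin 2 × Fin 2) × Fin 2 :=
    { toFun := fun t => ((t 0, t 1), t 2)
      invFun := fun p => ![p.1.1, p.1.2, p.2]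
      left_inv := fun t => by ext i; fin_cases i <;> rfl
      right_inv := fun p => rfl }
  refine Fintype.sum_equiv e _ (fun p => f ![p.1.1, p.1.2, p.2]) fun t => ?_
  exact congrArg f (e.symm_apply_apply t).symm

/-- The `±1`-valued outcome attached to `0` and `1`. -/
def outcomeSign (a : Fin 2) : ℝ := ![1, -1] a

@[simp] theorem outcomeSign_zero : outcomeSign 0 = 1 := rfl

@[simp] theorem outcomeSign_one : outcomeSign 1 = -1 := rfl

/-- The signed combination `∑ i, ± s i • A i` attached to an outcome tuple. -/
def signedSum {d : ℕ} (s : Fin 3 → ℝ) (A : Fin 3 → Matrix (Fin d) (Fin d) ℂ)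
    (t : Fin 3 → Fin 2) : Matrix (Fin d) (Fin d) ℂ :=
  ∑ i, (outcomeSign (t i) * s i) • A i

theorem isHermitian_real_smul {d : ℕ} {A : Matrix (Fin d) (Fin d) ℂ} (hA : A.IsHermitian)
    (r : ℝ) : (r • A).IsHermitian := by
  simp [Matrix.IsHermitian, Matrix.conjTranspose_smul, hA.eq]

theorem isHermitian_signedSum {d : ℕ} (s : Fin 3 → ℝ) {A : Fin 3 → Matrix (Fin d) (Fin d) ℂ}
    (hA : ∀ i, (A i).IsHermitian) (t : Fin 3 → Fin 2) : (signedSum s A t).IsHermitian := by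
  simp only [signedSum, Fin.sum_univ_three]
  exact ((isHermitian_real_smul (hA 0) _).add (isHermitian_real_smul (hA 1) _)).add
    (isHermitian_real_smul (hA 2) _)

theorem posSemidef_mul_self {d : ℕ} {A : Matrix (Fin d) (Fin d) ℂ} (hA : A.IsHermitian) :
    (A * A).PosSemidef := by
  simpa [hA.eq] using Matrix.posSemidef_conjTranspose_mul_self A

theorem posSemidef_real_smul {d : ℕ} {A : Matrix (Fin d) (Fin d) ℂ} (hA : A.PosSemidef)
    {r : ℝ} (hr : 0 ≤ r) : (r • A).PosSemidef :=
  hA.smul hr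

/-- Complementary effects `E`, `F` satisfy `(E - F)² ≤ 1`. -/
theorem posSemidef_one_sub_sq {d : ℕ} {E F : Matrix (Fin d) (Fin d) ℂ} (hE : E.PosSemidef)
    (hF : F.PosSemidef) (h : E + F = 1) : (1 - (E - F) * (E - F)).PosSemidef := by
  have h1 : (F * E * F).PosSemidef := by
    simpa [hF.isHermitian.eq] using hE.conjTranspose_mul_mul_same F
  have h2 : (E * F * E).PosSemidef := by
    simpa [hE.isHermitian.eq] using hF.conjTranspose_mul_mul_same E
  have h3 := posSemidef_real_smul (h1.add h2) (show (0 : ℝ) ≤ 4 by norm_num)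
  obtain rfl : F = 1 - E := eq_sub_of_add_eq' h
  convert h3 using 1
  simp only [mul_sub, sub_mul, mul_one, one_mul, mul_assoc]
  module

theorem smul_pow_mul_self {d : ℕ} (r : ℝ) (A : Matrix (Fin d) (Fin d) ℂ) :
    r ^ 2 • (A * A) = (r • A) * (r • A) := by
  rw [smul_mul_smul_comm, sq]

/-- For observables `A i = E i 0 - E i 1` and `s` in the Euclidean unit ball, the operators
`((1 + V t)² + 1 - ∑ i, (s i • A i)²) / 16`, with `V t` the signed sum, form a joint POVM. -/
theorem compatiblePOVMs_of_sum_sq_le_one {d : ℕ} (s : Fin 3 → ℝ)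
    (hs : s 0 ^ 2 + s 1 ^ 2 + s 2 ^ 2 ≤ 1) (E : Fin 3 → Fin 2 → Matrix (Fin d) (Fin d) ℂ)
    (hE : ∀ i, IsPOVM (E i)) :
    CompatiblePOVMs (k := fun _ => 2) (fun i j => s i • E i j +
        ((1 - s i) * ((2 : ℕ) : ℝ)⁻¹) • (1 : Matrix (Fin d) (Fin d) ℂ)) := by
  obtain ⟨A, hA⟩ : ∃ A : Fin 3 → Matrix (Fin d) (Fin d) ℂ, ∀ i, A i = E i 0 - E i 1 :=
    ⟨_, fun _ => rfl⟩
  have hsum : ∀ i, E i 0 + E i 1 = 1 := fun i => by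
    simpa [Fin.sum_univ_two] using (hE i).2
  have hAh : ∀ i, (A i).IsHermitian := fun i => by
    rw [hA]; exact ((hE i).1 0).isHermitian.sub ((hE i).1 1).isHermitian
  have hAsq : ∀ i, (1 - A i * A i).PosSemidef := fun i => by
    rw [hA]; exact posSemidef_one_sub_sq ((hE i).1 0) ((hE i).1 1) (hsum i)
  have hE0 : ∀ i, E i 0 = (1 / 2 : ℝ) • (1 + A i) := fun i => by
    rw [hA, ← hsum i]; module
  have hE1 : ∀ i, E i 1 = (1 / 2 : ℝ) • (1 - A i) := fun i => by
    rw [hA, ← hsum i]; module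
  have hrest : (1 - ∑ i, s i ^ 2 • (A i * A i)).PosSemidef := by
    have h1 := posSemidef_real_smul (Matrix.PosSemidef.one (n := Fin d) (R := ℂ))
      (sub_nonneg.2 hs)
    have h2 : ∀ i, (s i ^ 2 • (1 - A i * A i)).PosSemidef := fun i =>
      posSemidef_real_smul (hAsq i) (sq_nonneg _)
    convert ((h1.add (h2 0)).add (h2 1)).add (h2 2) using 1
    simp only [Fin.sum_univ_three]
    module
  refine ⟨fun t => (1 / 16 : ℝ) • ((1 + signedSum s A t) * (1 + signedSum s A t) +
    (1 - ∑ i, s i ^ 2 • (A i * A i))), fun t => ?_, ?_, ?_⟩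
  · exact posSemidef_real_smul ((posSemidef_mul_self
      (Matrix.isHermitian_one.add (isHermitian_signedSum s hAh t))).add hrest) (by norm_num)
  · rw [sum_fin_three_fin_two]
    simp [signedSum, Fin.sum_univ_three, Fin.sum_univ_two, mul_add, add_mul, smul_smul]
    module
  · intro i v
    rw [Finset.sum_filter, sum_fin_three_fin_two]
    have hv : s i • E i v + ((1 - s i) * ((2 : ℕ) : ℝ)⁻¹) • (1 : Matrix (Fin d) (Fin d) ℂ) =
        (1 / 2 : ℝ) • (1 + outcomeSign v • (s i • A i)) := by
      rcases Fin.exists_fin_two.1 ⟨v, rfl⟩ with rfl | rfl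
      · rw [hE0, outcomeSign_zero]; push_cast; module
      · rw [hE1, outcomeSign_one]; push_cast; module
    refine hv.trans ?_
    simp only [signedSum, mul_smul, smul_pow_mul_self, Fin.sum_univ_three, Fin.sum_univ_two]
    generalize hP : (fun i => s i • A i) = P
    simp only [funext_iff] at hP
    simp only [hP]
    fin_cases i <;> fin_cases v <;>
    · simp only [Fin.zero_eta, Fin.mk_one, Fin.reduceFinMk, Fin.isValue, Matrix.cons_val,
        if_true, if_false, zero_ne_one, one_ne_zero, outcomeSign_zero, outcomeSign_one, one_smul,
        neg_smul, mul_add, add_mul, mul_neg, neg_mul, mul_one, one_mul, add_zero, zero_add]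
      module

/-- The three Pauli matrices. -/
def pauli : Fin 3 → Matrix (Fin 2) (Fin 2) ℂ :=
  ![!![0, 1; 1, 0], !![0, -Complex.I; Complex.I, 0], !![1, 0; 0, -1]]

theorem isHermitian_pauli (i : Fin 3) : (pauli i).IsHermitian := by
  ext a b
  fin_cases i <;> fin_cases a <;> fin_cases b <;> simp [pauli]

theorem pauli_mul_self (i : Fin 3) : pauli i * pauli i = 1 := by
  ext a b
  fin_cases i <;> fin_cases a <;> fin_cases b <;> simp [pauli]

/-- The projective measurement of a Pauli matrix. -/
def pauliPOVM (i : Fin 3) (j : Fin 2) : Matrix (Fin 2) (Fin 2) ℂ :=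
  (1 / 2 : ℝ) • (1 + outcomeSign j • pauli i)

theorem isPOVM_pauliPOVM (i : Fin 3) : IsPOVM (pauliPOVM i) := by
  refine ⟨fun j => ?_, ?_⟩
  · have h := posSemidef_real_smul (posSemidef_mul_self (Matrix.isHermitian_one.add
      (isHermitian_real_smul (isHermitian_pauli i) (outcomeSign j))))
      (show (0 : ℝ) ≤ 1 / 4 by norm_num)
    convert h using 1
    fin_cases j <;> simp [pauliPOVM, mul_add, add_mul, pauli_mul_self] <;> module
  · simp only [pauliPOVM, Fin.sum_univ_two, outcomeSign_zero, outcomeSign_one]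
    module

theorem signedSum_pauli_mul_self (s : Fin 3 → ℝ) (t : Fin 3 → Fin 2) :
    signedSum s pauli t * signedSum s pauli t = (s 0 ^ 2 + s 1 ^ 2 + s 2 ^ 2) • 1 := by
  have h : ∀ a, ((outcomeSign a : ℝ) : ℂ) ^ 2 = 1 := fun a => by
    fin_cases a <;> simp
  ext a b
  fin_cases a <;> fin_cases b <;>
    simp [signedSum, Fin.sum_univ_three, pauli, Matrix.mul_apply, Fin.sum_univ_two] <;>
    ring_nf <;> simp [h]

theorem sum_sq_le_one_of_compatiblePOVMs (s : Fin 3 → ℝ)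
    (h : CompatiblePOVMs (k := fun _ => 2) (fun i j => s i • pauliPOVM i j +
        ((1 - s i) * ((2 : ℕ) : ℝ)⁻¹) • (1 : Matrix (Fin 2) (Fin 2) ℂ))) :
    s 0 ^ 2 + s 1 ^ 2 + s 2 ^ 2 ≤ 1 := by
  obtain ⟨R, hR, hsum, hmarg⟩ := h
  set r := s 0 ^ 2 + s 1 ^ 2 + s 2 ^ 2 with hr
  have hpos : ∀ t, 0 ≤ (((1 + r) • R t - (2 : ℝ) • (signedSum s pauli t * R t)).trace).re := by
    intro t
    have hH : (1 - signedSum s pauli t).IsHermitian :=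
      Matrix.isHermitian_one.sub (isHermitian_signedSum s isHermitian_pauli t)
    have h1 := ((hR t).conjTranspose_mul_mul_same (1 - signedSum s pauli t)).trace_nonneg
    rw [hH.eq, Matrix.trace_mul_comm, ← mul_assoc] at h1
    have h2 : (1 - signedSum s pauli t) * (1 - signedSum s pauli t) =
        (1 + r) • 1 - (2 : ℝ) • signedSum s pauli t := by
      simp only [mul_sub, sub_mul, mul_one, one_mul, signedSum_pauli_mul_self]
      module
    rw [h2, sub_mul, smul_mul_assoc, smul_mul_assoc, one_mul] at h1
    exact (Complex.le_def.1 h1).1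
  have hodd : ∀ i, ∑ t : Fin 3 → Fin 2, outcomeSign (t i) • R t = s i • pauli i := by
    intro i
    have h0 := hmarg i 0
    have h1 := hmarg i 1
    have h2 : s i • pauli i = ∑ t ∈ Finset.univ.filter (fun t : Fin 3 → Fin 2 => t i = 0), R t -
        ∑ t ∈ Finset.univ.filter (fun t : Fin 3 → Fin 2 => t i = 1), R t := by
      refine Eq.trans ?_ (congrArg₂ (· - ·) h0 h1)
      simp only [pauliPOVM, outcomeSign_zero, outcomeSign_one]
      module
    rw [h2, Finset.sum_filter, Finset.sum_filter, ← Finset.sum_sub_distrib]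
    refine Finset.sum_congr rfl fun t _ => ?_
    rcases Fin.exists_fin_two.1 ⟨t i, rfl⟩ with ht | ht <;> simp [ht]
  have hV : ∑ t, signedSum s pauli t * R t = r • 1 := by
    have h1 : ∀ t, signedSum s pauli t * R t =
        ∑ i, s i • (pauli i * (outcomeSign (t i) • R t)) := fun t => by
      simp [signedSum, Finset.sum_mul, smul_smul, mul_comm]
    simp only [h1]
    rw [Finset.sum_comm]
    simp only [← Finset.smul_sum, ← Finset.mul_sum, hodd]
    simp only [mul_smul_comm, pauli_mul_self, Fin.sum_univ_three, hr]
    module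
  have hfin := Finset.sum_nonneg fun t (_ : t ∈ Finset.univ) => hpos t
  rw [← Complex.re_sum, ← Matrix.trace_sum, Finset.sum_sub_distrib, ← Finset.smul_sum,
    ← Finset.smul_sum, hV] at hfin
  have hsum' : ∑ t : Fin 3 → Fin 2, R t = 1 := hsum
  rw [hsum'] at hfin
  simp at hfin
  linarith

/-- `Γ(3, 2) = {s ∈ [0,1]^3 : s₁² + s₂² + s₃² ≤ 1}`. -/
theorem gamma_three_qubit :
    Gamma 3 2 (fun _ => 2) =
      {s : Fin 3 → ℝ | (∀ i, s i ∈ Set.Icc (0 : ℝ) 1) ∧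
        s 0 ^ 2 + s 1 ^ 2 + s 2 ^ 2 ≤ 1} := by
  ext s
  refine ⟨fun ⟨h1, h2⟩ => ⟨h1, ?_⟩, fun ⟨h1, h2⟩ => ⟨h1, fun E hE => ?_⟩⟩
  · exact sum_sq_le_one_of_compatiblePOVMs s (h2 pauliPOVM isPOVM_pauliPOVM)
  · exact compatiblePOVMs_of_sum_sq_le_one s h2 E hE
end
end

section
/- For all positive integers g and d, the compatibility norm ‖·‖_c is a norm on g-tuples of d×d Hermitian complex matrices: ‖A‖_c = 0 if and only if A = 0; ‖cA‖_c = |c|·‖A‖_c for all scalars c ∈ ℝ; and ‖A + B‖_c ≤ ‖A‖_c + ‖B‖_c for all g-tuples A, B of d×d Hermitian matrices. -/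
open Matrix ComplexOrder

noncomputable section

/-- The largest eigenvalue of a (Hermitian) matrix, characterized via the Loewner order. -/
noncomputable def lambdaMax {d : ℕ} (M : Matrix (Fin d) (Fin d) ℂ) : ℝ :=
  sInf {t : ℝ | (t • (1 : Matrix (Fin d) (Fin d) ℂ) - M).PosSemidef}

/-- The compatibility norm `‖A‖_c`: infimum of `λ_max (∑ j, H j)` over finite decompositions
`A i = ∑ j, z j i • H j` with `‖z j‖_∞ ≤ 1` and `H j` positive semidefinite. -/
noncomputable def cNorm {g d : ℕ} (A : Fin g → Matrix (Fin d) (Fin d) ℂ) : ℝ :=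
  sInf {t : ℝ | ∃ (n : ℕ) (z : Fin n → Fin g → ℝ) (H : Fin n → Matrix (Fin d) (Fin d) ℂ),
    (∀ j i, |z j i| ≤ 1) ∧ (∀ j, (H j).PosSemidef) ∧
    (∀ i, A i = ∑ j, z j i • H j) ∧ t = lambdaMax (∑ j, H j)}

section LambdaMax

variable {d : ℕ}

open scoped MatrixOrder Matrix.Norms.L2Operator in
/-- A Hermitian matrix lies below some real multiple of the identity. -/
theorem exists_smul_one_sub_posSemidef {M : Matrix (Fin d) (Fin d) ℂ} (hM : M.IsHermitian) :
    ∃ t : ℝ, (t • (1 : Matrix (Fin d) (Fin d) ℂ) - M).PosSemidef := by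
  have hM' : IsSelfAdjoint M := hM
  have h := hM'.le_algebraMap_norm_self
  rw [Algebra.algebraMap_eq_smul_one] at h
  exact ⟨_, Matrix.le_iff.mp h⟩

open scoped MatrixOrder Matrix.Norms.L2Operator in
/-- A matrix lying below every positive multiple of the identity is negative semidefinite. -/
theorem neg_posSemidef_of_forall_pos {M : Matrix (Fin d) (Fin d) ℂ}
    (h : ∀ ε : ℝ, 0 < ε → (ε • (1 : Matrix (Fin d) (Fin d) ℂ) - M).PosSemidef) :
    (-M).PosSemidef := by
  have hlim : Filter.Tendsto (fun ε : ℝ => ε • (1 : Matrix (Fin d) (Fin d) ℂ) - M)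
      (nhdsWithin 0 (Set.Ioi 0)) (nhds (-M)) := by
    have hc : Continuous fun ε : ℝ => ε • (1 : Matrix (Fin d) (Fin d) ℂ) - M := by fun_prop
    simpa using (hc.tendsto 0).mono_left nhdsWithin_le_nhds
  rw [← Matrix.nonneg_iff_posSemidef]
  refine ge_of_tendsto hlim ?_
  filter_upwards [self_mem_nhdsWithin] with ε hε
  exact (h ε hε).nonneg

theorem nonneg_of_smul_one_sub_posSemidef (hd : 0 < d) {M : Matrix (Fin d) (Fin d) ℂ}
    (hM : M.PosSemidef) {t : ℝ} (ht : (t • (1 : Matrix (Fin d) (Fin d) ℂ) - M).PosSemidef) :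
    0 ≤ t := by
  have h := (ht.add hM).diag_nonneg (i := ⟨0, hd⟩)
  simpa using h

theorem smul_one_sub_posSemidef_mono {M : Matrix (Fin d) (Fin d) ℂ} {s t : ℝ} (hst : s ≤ t)
    (hs : (s • (1 : Matrix (Fin d) (Fin d) ℂ) - M).PosSemidef) :
    (t • (1 : Matrix (Fin d) (Fin d) ℂ) - M).PosSemidef := by
  have h := (Matrix.PosSemidef.one (n := Fin d) (R := ℂ)).smul (sub_nonneg.mpr hst)
  convert h.add hs using 1
  module

theorem lambdaMax_nonneg (hd : 0 < d) {M : Matrix (Fin d) (Fin d) ℂ} (hM : M.PosSemidef) :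
    0 ≤ lambdaMax M :=
  Real.sInf_nonneg fun _ ht => nonneg_of_smul_one_sub_posSemidef hd hM ht

theorem lambdaMax_le (hd : 0 < d) {M : Matrix (Fin d) (Fin d) ℂ} (hM : M.PosSemidef) {t : ℝ}
    (ht : (t • (1 : Matrix (Fin d) (Fin d) ℂ) - M).PosSemidef) : lambdaMax M ≤ t :=
  csInf_le ⟨0, fun _ hs => nonneg_of_smul_one_sub_posSemidef hd hM hs⟩ ht

theorem smul_one_sub_posSemidef_of_lambdaMax_lt {M : Matrix (Fin d) (Fin d) ℂ}
    (hM : M.IsHermitian) {t : ℝ} (ht : lambdaMax M < t) :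
    (t • (1 : Matrix (Fin d) (Fin d) ℂ) - M).PosSemidef := by
  obtain ⟨s, hs, hst⟩ := exists_lt_of_csInf_lt (exists_smul_one_sub_posSemidef hM) ht
  exact smul_one_sub_posSemidef_mono hst.le hs

end LambdaMax

section CompatibilityNorm

variable {g d : ℕ} {A B : Fin g → Matrix (Fin d) (Fin d) ℂ}

theorem cNorm_nonneg (hd : 0 < d) (A : Fin g → Matrix (Fin d) (Fin d) ℂ) : 0 ≤ cNorm A := by
  refine Real.sInf_nonneg ?_
  rintro _ ⟨n, z, H, -, hH, -, rfl⟩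
  exact lambdaMax_nonneg hd (Matrix.posSemidef_sum _ fun j _ => hH j)

theorem cNorm_le (hd : 0 < d) {ι : Type*} [Fintype ι] {z : ι → Fin g → ℝ}
    {H : ι → Matrix (Fin d) (Fin d) ℂ} (hz : ∀ j i, |z j i| ≤ 1) (hH : ∀ j, (H j).PosSemidef)
    (hA : ∀ i, A i = ∑ j, z j i • H j) {t : ℝ}
    (ht : (t • (1 : Matrix (Fin d) (Fin d) ℂ) - ∑ j, H j).PosSemidef) : cNorm A ≤ t := by
  refine le_trans (csInf_le ⟨0, ?_⟩ ?_)
    (lambdaMax_le hd (Matrix.posSemidef_sum _ fun j _ => hH j) ht)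
  · rintro _ ⟨n, z, H, -, hH, -, rfl⟩
    exact lambdaMax_nonneg hd (Matrix.posSemidef_sum _ fun j _ => hH j)
  · let e := (Fintype.equivFin ι).symm
    refine ⟨Fintype.card ι, z ∘ e, H ∘ e, fun j => hz _, fun j => hH _, fun i => ?_, ?_⟩
    · exact (hA i).trans (e.sum_comp fun j => z j i • H j).symm
    · exact congrArg lambdaMax (e.sum_comp H).symm

open scoped MatrixOrder Matrix.Norms.L2Operator in
/-- Every tuple of Hermitian matrices admits a decomposition, obtained by splitting each entry
into its positive and negative parts. -/
theorem exists_decomposition (hA : ∀ i, (A i).IsHermitian) :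
    ∃ (n : ℕ) (z : Fin n → Fin g → ℝ) (H : Fin n → Matrix (Fin d) (Fin d) ℂ),
      (∀ j i, |z j i| ≤ 1) ∧ (∀ j, (H j).PosSemidef) ∧ ∀ i, A i = ∑ j, z j i • H j := by
  refine ⟨g + g, Fin.append (fun j i => if i = j then 1 else 0)
    (fun j i => if i = j then -1 else 0), Fin.append (fun j => (A j)⁺) (fun j => (A j)⁻),
    fun j i => ?_, fun j => ?_, fun i => ?_⟩
  · refine Fin.addCases (fun j => ?_) (fun j => ?_) j <;>
      simp only [Fin.append_left, Fin.append_right] <;> split_ifs <;> simp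
  · refine Fin.addCases (fun j => ?_) (fun j => ?_) j
    · simpa only [Fin.append_left] using
        Matrix.nonneg_iff_posSemidef.mp (CFC.posPart_nonneg (A j))
    · simpa only [Fin.append_right] using
        Matrix.nonneg_iff_posSemidef.mp (CFC.negPart_nonneg (A j))
  · have hAi : IsSelfAdjoint (A i) := hA i
    have h := CFC.posPart_sub_negPart (A i) hAi
    simp only [Fin.sum_univ_add, Fin.append_left, Fin.append_right]
    simpa [ite_smul, sub_eq_add_neg] using h.symm

theorem exists_decomposition_of_cNorm_lt (hA : ∀ i, (A i).IsHermitian) {t : ℝ}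
    (ht : cNorm A < t) :
    ∃ (n : ℕ) (z : Fin n → Fin g → ℝ) (H : Fin n → Matrix (Fin d) (Fin d) ℂ),
      (∀ j i, |z j i| ≤ 1) ∧ (∀ j, (H j).PosSemidef) ∧ (∀ i, A i = ∑ j, z j i • H j) ∧
      (t • (1 : Matrix (Fin d) (Fin d) ℂ) - ∑ j, H j).PosSemidef := by
  obtain ⟨n, z, H, hz, hH, hAH⟩ := exists_decomposition hA
  obtain ⟨_, ⟨n, z, H, hz, hH, hAH, rfl⟩, hlt⟩ :=
    exists_lt_of_csInf_lt (by exact ⟨_, n, z, H, hz, hH, hAH, rfl⟩) ht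
  exact ⟨n, z, H, hz, hH, hAH,
    smul_one_sub_posSemidef_of_lambdaMax_lt (Matrix.posSemidef_sum _ fun j _ => hH j).1 hlt⟩

/-- The sum of a decomposition dominates every matrix in the tuple. -/
theorem smul_one_sub_posSemidef_of_cNorm_lt (hA : ∀ i, (A i).IsHermitian) {t : ℝ}
    (ht : cNorm A < t) (i : Fin g) :
    (t • (1 : Matrix (Fin d) (Fin d) ℂ) - A i).PosSemidef := by
  obtain ⟨n, z, H, hz, hH, hAH, hs⟩ := exists_decomposition_of_cNorm_lt hA ht
  have h : (∑ j, (1 - z j i) • H j).PosSemidef := Matrix.posSemidef_sum _ fun j _ =>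
    (hH j).smul (sub_nonneg.mpr (le_of_abs_le (hz j i)))
  convert hs.add h using 1
  simp only [sub_smul, one_smul, Finset.sum_sub_distrib, hAH i]
  abel

theorem cNorm_smul_le (hd : 0 < d) (hA : ∀ i, (A i).IsHermitian) (c : ℝ) :
    cNorm (fun i => c • A i) ≤ |c| * cNorm A := by
  have key : ∀ t, cNorm A < t → cNorm (fun i => c • A i) ≤ |c| * t := by
    intro t ht
    obtain ⟨n, z, H, hz, hH, hAH, hs⟩ := exists_decomposition_of_cNorm_lt hA ht
    refine cNorm_le hd (z := fun j i => SignType.sign c * z j i) (H := fun j => |c| • H j)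
      (fun j i => ?_) (fun j => (hH j).smul (abs_nonneg c)) (fun i => ?_) ?_
    · rw [abs_mul]
      refine mul_le_one₀ ?_ (abs_nonneg _) (hz j i)
      rcases lt_trichotomy c 0 with h | h | h <;> simp [h]
    · simp only [hAH i, Finset.smul_sum, smul_smul]
      refine Finset.sum_congr rfl fun j _ => ?_
      rw [mul_right_comm, sign_mul_abs]
    · convert hs.smul (abs_nonneg c) using 1
      rw [smul_sub, Finset.smul_sum, smul_smul]
  refine ge_of_tendsto (x := nhdsWithin (cNorm A) (Set.Ioi (cNorm A)))
    (f := fun t => |c| * t) ?_ ?_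
  · exact ((continuous_const_mul |c|).tendsto _).mono_left nhdsWithin_le_nhds
  · filter_upwards [self_mem_nhdsWithin] with t ht using key t ht

theorem cNorm_smul (hd : 0 < d) (hA : ∀ i, (A i).IsHermitian) (c : ℝ) :
    cNorm (fun i => c • A i) = |c| * cNorm A := by
  refine (cNorm_smul_le hd hA c).antisymm ?_
  rcases eq_or_ne c 0 with rfl | hc
  · simpa using cNorm_nonneg hd _
  have h := cNorm_smul_le hd (A := fun i => c • A i) (fun i => (hA i).smul (.all c)) c⁻¹
  simp only [smul_smul, inv_mul_cancel₀ hc, one_smul] at h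
  rwa [abs_inv, inv_mul_eq_div, le_div_iff₀' (abs_pos.mpr hc)] at h

theorem cNorm_add_le (hd : 0 < d) (hA : ∀ i, (A i).IsHermitian) (hB : ∀ i, (B i).IsHermitian) :
    cNorm (fun i => A i + B i) ≤ cNorm A + cNorm B := by
  refine le_of_forall_pos_le_add fun ε hε => ?_
  obtain ⟨n, z, H, hz, hH, hAH, hs⟩ :=
    exists_decomposition_of_cNorm_lt hA (lt_add_of_pos_right _ (half_pos hε))
  obtain ⟨m, w, K, hw, hK, hBK, hr⟩ :=
    exists_decomposition_of_cNorm_lt hB (lt_add_of_pos_right _ (half_pos hε))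
  refine cNorm_le hd (z := Sum.elim z w) (H := Sum.elim H K) (Sum.rec hz hw) (Sum.rec hH hK)
    (fun i => ?_) ?_
  · simp [hAH i, hBK i]
  · convert hs.add hr using 1
    simp only [Fintype.sum_sum_type, Sum.elim_inl, Sum.elim_inr]
    module

open scoped MatrixOrder in
theorem cNorm_eq_zero_iff (hd : 0 < d) (hA : ∀ i, (A i).IsHermitian) :
    cNorm A = 0 ↔ A = 0 := by
  constructor
  · intro h
    funext i
    have hneg : (-A i).PosSemidef := neg_posSemidef_of_forall_pos fun ε hε =>
      smul_one_sub_posSemidef_of_cNorm_lt hA (h ▸ hε) i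
    have hpos : (-((-1 : ℝ) • A i)).PosSemidef := neg_posSemidef_of_forall_pos fun ε hε =>
      smul_one_sub_posSemidef_of_cNorm_lt (A := fun i => (-1 : ℝ) • A i)
        (fun i => (hA i).smul (.all _)) (by rwa [cNorm_smul hd hA, h, mul_zero]) i
    rw [neg_smul, one_smul, neg_neg] at hpos
    exact le_antisymm (neg_nonneg.mp hneg.nonneg) hpos.nonneg
  · rintro rfl
    simpa [← Pi.zero_def] using cNorm_smul hd hA 0

end CompatibilityNorm

/-- `‖·‖_c` is a norm on `g`-tuples of `d × d` Hermitian matrices. -/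
theorem cNorm_is_norm (g d : ℕ) (hg : 0 < g) (hd : 0 < d) :
    (∀ A : Fin g → Matrix (Fin d) (Fin d) ℂ, (∀ i, (A i).IsHermitian) →
      (cNorm A = 0 ↔ A = 0)) ∧
    (∀ (c : ℝ) (A : Fin g → Matrix (Fin d) (Fin d) ℂ), (∀ i, (A i).IsHermitian) →
      cNorm (fun i => c • A i) = |c| * cNorm A) ∧
    (∀ A B : Fin g → Matrix (Fin d) (Fin d) ℂ,
      (∀ i, (A i).IsHermitian) → (∀ i, (B i).IsHermitian) →
      cNorm (fun i => A i + B i) ≤ cNorm A + cNorm B) := by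
  exact ⟨fun A hA => cNorm_eq_zero_iff hd hA, fun c A hA => cNorm_smul hd hA c,
    fun A B hA hB => cNorm_add_le hd hA hB⟩
end
end

section
/- Let A = (A_1,…,A_g) be a g-tuple of d×d Hermitian complex matrices. Then ‖A‖_c equals the infimum of λ_max(∑_{ε ∈ {−1,1}^g} K_ε) over all families (K_ε)_{ε ∈ {−1,1}^g} of d×d positive semidefinite matrices satisfying A_i = ∑_{ε ∈ {−1,1}^g} ε_i K_ε for all i ∈ [g]. That is, the general optimization defining ‖·‖_c reduces to a semidefinite program whose decomposition vectors are the 2^g sign vectors. -/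
open Matrix ComplexOrder

noncomputable section

/-- The probability of the sign pattern `ε` under independent signs whose means are `x i`. -/
def signWeight {ι : Type*} [Fintype ι] (x : ι → ℝ) (ε : ι → Bool) : ℝ :=
  ∏ i, (if ε i then (1 + x i) / 2 else (1 - x i) / 2)

lemma signWeight_nonneg {ι : Type*} [Fintype ι] {x : ι → ℝ} (hx : ∀ i, |x i| ≤ 1)
    (ε : ι → Bool) : 0 ≤ signWeight x ε := by
  refine Finset.prod_nonneg fun i _ => ?_
  have h := abs_le.1 (hx i)
  split_ifs <;> linarith

lemma sum_prod_bool {ι : Type*} [Fintype ι] [DecidableEq ι] (f : ι → Bool → ℝ) :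
    ∑ ε : ι → Bool, ∏ i, f i (ε i) = ∏ i, (f i true + f i false) := by
  rw [← Fintype.piFinset_univ, ← Finset.prod_univ_sum]
  simp

lemma sum_signWeight {ι : Type*} [Fintype ι] [DecidableEq ι] (x : ι → ℝ) :
    ∑ ε : ι → Bool, signWeight x ε = 1 := by
  unfold signWeight
  rw [sum_prod_bool fun i b => if b then (1 + x i) / 2 else (1 - x i) / 2]
  refine Finset.prod_eq_one fun i _ => ?_
  simp only [if_true, Bool.false_eq_true, if_false]
  ring

lemma sum_sign_mul_signWeight {ι : Type*} [Fintype ι] [DecidableEq ι] (x : ι → ℝ) (i : ι) :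
    ∑ ε : ι → Bool, (if ε i then (1 : ℝ) else -1) * signWeight x ε = x i := by
  have key : ∀ ε : ι → Bool, (if ε i then (1 : ℝ) else -1) * signWeight x ε =
      ∏ k, ((if k = i then (if ε k then (1 : ℝ) else -1) else 1) *
        (if ε k then (1 + x k) / 2 else (1 - x k) / 2)) := by
    intro ε
    rw [Finset.prod_mul_distrib, Finset.prod_ite_eq' Finset.univ i]
    simp [signWeight]
  simp only [key]
  rw [sum_prod_bool fun k b => (if k = i then (if b then (1 : ℝ) else -1) else 1) *
    (if b then (1 + x k) / 2 else (1 - x k) / 2), Finset.prod_eq_single i]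
  · simp only [if_true, Bool.false_eq_true, if_false]
    ring
  · intro k _ hk
    simp only [hk, if_true, Bool.false_eq_true, if_false]
    ring
  · simp

/-- the optimization defining `‖·‖_c` reduces to an SDP whose decomposition vectors
are the `2^g` sign vectors. -/
theorem cNorm_SDP (g d : ℕ) (A : Fin g → Matrix (Fin d) (Fin d) ℂ)
    (hA : ∀ i, (A i).IsHermitian) :
    cNorm A = sInf {t : ℝ | ∃ K : (Fin g → Bool) → Matrix (Fin d) (Fin d) ℂ,
      (∀ ε, (K ε).PosSemidef) ∧
      (∀ i, A i = ∑ ε : Fin g → Bool, (if ε i then (1 : ℝ) else -1) • K ε) ∧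
      t = lambdaMax (∑ ε : Fin g → Bool, K ε)} := by
  unfold cNorm
  congr 1
  ext t
  constructor
  · rintro ⟨n, z, H, hz, hH, hAz, rfl⟩
    refine ⟨fun ε => ∑ j, signWeight (z j) ε • H j, fun ε => ?_, fun i => ?_, ?_⟩
    · exact posSemidef_sum _ fun j _ => (hH j).smul (signWeight_nonneg (hz j) ε)
    · simp only [Finset.smul_sum, smul_smul]
      rw [Finset.sum_comm, hAz i]
      simp only [← Finset.sum_smul, sum_sign_mul_signWeight]
    · rw [Finset.sum_comm]
      simp only [← Finset.sum_smul, sum_signWeight, one_smul]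
  · rintro ⟨K, hK, hAK, rfl⟩
    let e := (Fintype.equivFin (Fin g → Bool)).symm
    refine ⟨_, fun j i => if e j i then 1 else -1, fun j => K (e j), fun j i => ?_,
      fun j => hK _, fun i => ?_, ?_⟩
    · dsimp only
      split_ifs <;> simp
    · rw [hAK i]
      exact (e.sum_comp fun ε => (if ε i then (1 : ℝ) else -1) • K ε).symm
    · rw [e.sum_comp K]
end
end

section
/- Let g, d be positive integers and s ∈ [0,1]^g. The following two conditions are equivalent: (i) for every g-tuple (X_1,…,X_g) of d×d Hermitian matrices with −I ≤ X_i ≤ I for all i, there exist finitely many vectors z_j ∈ [−1,1]^g and positive semidefinite matrices H_j with ∑_j H_j = I and s_i X_i = ∑_j z_j(i) H_j for all i; (ii) for every g-tuple (X_1,…,X_g) of d×d Hermitian matrices with ∑_{i=1}^g ε_i X_i ≤ I for all sign vectors ε ∈ {−1,1}^g, there exist positive semidefinite matrices P_1,…,P_g, N_1,…,N_g with s_i X_i = P_i − N_i for all i and ∑_{i=1}^g (P_i + N_i) ≤ I. In other words, the matrix cube inclusion set Δ_□(g,d) equals the matrix diamond inclusion set Δ_◇(g,d). -/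
open Matrix ComplexOrder

noncomputable section

namespace Matrix

variable {n ι κ : Type*}

open scoped MatrixOrder in
lemma PosSemidef.exists_eq_conjTranspose_mul_self [Fintype n] [DecidableEq n] {A : Matrix n n ℂ} (hA : A.PosSemidef) :
    ∃ R : Matrix n n ℂ, A = Rᴴ * R :=
  CStarAlgebra.nonneg_iff_eq_star_mul_self.mp hA.nonneg

lemma PosDef.exists_isUnit_eq_conjTranspose_mul_self [Fintype n] [DecidableEq n] {A : Matrix n n ℂ} (hA : A.PosDef) :
    ∃ R : Matrix n n ℂ, IsUnit R ∧ A = Rᴴ * R := by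
  obtain ⟨R, hR⟩ := hA.posSemidef.exists_eq_conjTranspose_mul_self
  refine ⟨R, ?_, hR⟩
  have hdet := hA.isUnit
  rw [hR, isUnit_iff_isUnit_det, det_mul] at hdet
  exact (isUnit_iff_isUnit_det R).2 (isUnit_of_mul_isUnit_right hdet)

lemma PosSemidef.re_trace_mul_nonneg [Fintype n] [DecidableEq n] {A B : Matrix n n ℂ} (hA : A.PosSemidef)
    (hB : B.PosSemidef) : 0 ≤ (A * B).trace.re := by
  obtain ⟨R, rfl⟩ := hA.exists_eq_conjTranspose_mul_self
  rw [Matrix.mul_assoc, trace_mul_comm]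
  exact (Complex.le_def.1 (hB.mul_mul_conjTranspose_same R).trace_nonneg).1

lemma PosSemidef.norm_apply_le_re_trace [Fintype n] [DecidableEq n] {A : Matrix n n ℂ} (hA : A.PosSemidef) (i j : n) :
    ‖A i j‖ ≤ A.trace.re := by
  obtain ⟨R, rfl⟩ := hA.exists_eq_conjTranspose_mul_self
  have hdiag (i : n) : ((Rᴴ * R) i i).re = ∑ k, ‖R k i‖ ^ 2 := by
    simp only [mul_apply, conjTranspose_apply, Complex.re_sum]
    refine Finset.sum_congr rfl fun k _ ↦ ?_
    rw [Complex.sq_norm, Complex.normSq_apply]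
    simp
  have hcol (i : n) : ∑ k, ‖R k i‖ ^ 2 ≤ (Rᴴ * R).trace.re := by
    simp only [trace, diag_apply, Complex.re_sum, hdiag]
    exact Finset.single_le_sum (f := fun i ↦ ∑ k, ‖R k i‖ ^ 2)
      (fun _ _ ↦ by positivity) (Finset.mem_univ i)
  calc ‖(Rᴴ * R) i j‖ ≤ ∑ k, (‖R k i‖ ^ 2 + ‖R k j‖ ^ 2) / 2 := by
        rw [mul_apply]
        refine norm_sum_le_of_le _ fun k _ ↦ ?_
        rw [norm_mul, conjTranspose_apply, norm_star]
        nlinarith [sq_nonneg (‖R k i‖ - ‖R k j‖)]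
    _ = (∑ k, ‖R k i‖ ^ 2 + ∑ k, ‖R k j‖ ^ 2) / 2 := by
        rw [← Finset.sum_div, Finset.sum_add_distrib]
    _ ≤ (Rᴴ * R).trace.re := by linarith [hcol i, hcol j]

lemma isClosed_posSemidef [Fintype n] : IsClosed {A : Matrix n n ℂ | A.PosSemidef} := by
  simp only [posSemidef_iff_dotProduct_mulVec, Set.ofPred_and, Set.ofPred_forall]
  refine IsClosed.inter (isClosed_eq (by fun_prop) continuous_id) (isClosed_iInter fun x ↦ ?_)
  exact isClosed_le continuous_const (by fun_prop)

lemma PosSemidef.real_smul {A : Matrix n n ℂ} (hA : A.PosSemidef) {t : ℝ} (ht : 0 ≤ t) :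
    (t • A).PosSemidef :=
  hA.smul ht

lemma IsHermitian.real_smul {A : Matrix n n ℂ} (hA : A.IsHermitian) (t : ℝ) :
    (t • A).IsHermitian := by
  simp [IsHermitian, conjTranspose_smul, hA.eq]

lemma isHermitian_real_combination [Fintype ι] {A : ι → Matrix n n ℂ} (hA : ∀ i, (A i).IsHermitian)
    (c : ι → ℝ) : (∑ i, c i • A i).IsHermitian := by
  simp [IsHermitian, conjTranspose_sum, conjTranspose_smul, (hA _).eq]

lemma trace_mul_vecMulVec_star [Fintype n] (A : Matrix n n ℂ) (v : n → ℂ) :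
    (A * vecMulVec v (star v)).trace = star v ⬝ᵥ (A *ᵥ v) := by
  rw [mul_vecMulVec, trace_vecMulVec, dotProduct_comm]

/-- A real linear functional is represented, on Hermitian matrices, by a Hermitian matrix. -/
lemma exists_isHermitian_re_trace_mul [Fintype n] [DecidableEq n] (f : Matrix n n ℂ →ₗ[ℝ] ℝ) :
    ∃ A : Matrix n n ℂ, A.IsHermitian ∧
      ∀ X : Matrix n n ℂ, X.IsHermitian → f X = (A * X).trace.re := by
  let B : Matrix n n ℂ := of fun j i ↦ ⟨f (single i j 1), -f (single i j Complex.I)⟩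
  have hB (X : Matrix n n ℂ) : f X = (B * X).trace.re := by
    have hs (i j : n) (z : ℂ) :
        single i j z = z.re • single i j (1 : ℂ) + z.im • single i j Complex.I := by
      rw [smul_single, smul_single, ← single_add]
      simp [Complex.re_add_im]
    conv_lhs => rw [matrix_eq_sum_single X]
    simp only [trace, diag_apply, mul_apply, Complex.re_sum, map_sum]
    rw [Finset.sum_comm]
    refine Finset.sum_congr rfl fun j _ ↦ Finset.sum_congr rfl fun i _ ↦ ?_
    rw [hs, map_add, map_smul, map_smul]
    simp [B]
    ring
  refine ⟨(1 / 2 : ℝ) • (B + Bᴴ), ?_, fun X hX ↦ ?_⟩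
  · exact (isHermitian_add_transpose_self B).real_smul _
  · have : (Bᴴ * X).trace.re = (B * X).trace.re := by
      have h : (Bᴴ * X).trace = star (B * X).trace := by
        rw [← trace_conjTranspose, conjTranspose_mul, hX.eq, trace_mul_comm]
      simp [h]
    rw [smul_mul, trace_smul, Matrix.add_mul, trace_add, Complex.smul_re, Complex.add_re, this,
      hB X, smul_eq_mul]
    ring

/-- The tuples of positive semidefinite matrices with prescribed total trace. -/
def posSemidefTuples (κ n : Type*) [Fintype κ] [Fintype n] (c : ℝ) :
    Set (κ → Matrix n n ℂ) :=
  {H | (∀ k, (H k).PosSemidef) ∧ ∑ k, (H k).trace.re = c}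

lemma convex_posSemidefTuples [Fintype κ] [Fintype n] (c : ℝ) :
    Convex ℝ (posSemidefTuples κ n c) := by
  rintro H ⟨hH, hHc⟩ K ⟨hK, hKc⟩ a b ha hb hab
  refine ⟨fun k ↦ ((hH k).real_smul ha).add ((hK k).real_smul hb), ?_⟩
  simp only [Pi.add_apply, Pi.smul_apply, trace_add, trace_smul, Complex.add_re, Complex.smul_re,
    smul_eq_mul, Finset.sum_add_distrib, ← Finset.mul_sum, hHc, hKc]
  rw [← add_mul, hab, one_mul]

lemma isCompact_posSemidefTuples [Fintype κ] [Fintype n] [DecidableEq n] (c : ℝ) :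
    IsCompact (posSemidefTuples κ n c) := by
  have hK : IsCompact (Set.univ.pi fun _ : κ ↦ Set.univ.pi fun _ : n ↦ Set.univ.pi fun _ : n ↦
      Metric.closedBall (0 : ℂ) c) :=
    isCompact_univ_pi fun _ ↦ isCompact_univ_pi fun _ ↦ isCompact_univ_pi fun _ ↦
      isCompact_closedBall _ _
  refine IsCompact.of_isClosed_subset hK ?_ ?_
  · simp only [posSemidefTuples, Set.ofPred_and, Set.ofPred_forall]
    refine IsClosed.inter (isClosed_iInter fun k ↦ ?_) ?_
    · exact isClosed_posSemidef.preimage (continuous_apply (A := fun _ : κ ↦ Matrix n n ℂ) k)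
    · exact isClosed_eq (by fun_prop) continuous_const
  · rintro H ⟨hH, hc⟩ k - i - j -
    rw [mem_closedBall_zero_iff]
    refine ((hH k).norm_apply_le_re_trace i j).trans (le_of_le_of_eq ?_ hc)
    exact Finset.single_le_sum (f := fun k ↦ (H k).trace.re)
      (fun k _ ↦ (Complex.le_def.1 (hH k).trace_nonneg).1) (Finset.mem_univ k)

/-- A Farkas-type lemma: `X` is a combination, with positive semidefinite weights summing to the
identity, of the points `a k`, provided no affine pencil positive on these points is negative
at `X`. -/
theorem exists_posSemidef_combination [Fintype n] [DecidableEq n] [Nonempty n] [Fintype ι]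
    [Fintype κ] (a : κ → ι → ℝ) (X : ι → Matrix n n ℂ)
    (hX : ∀ i, (X i).IsHermitian)
    (h : ∀ (B : Matrix n n ℂ) (A : ι → Matrix n n ℂ), B.IsHermitian → (∀ i, (A i).IsHermitian) →
      (∀ k, (B + ∑ i, a k i • A i).PosDef) →
      0 ≤ B.trace.re + ∑ i, (A i * X i).trace.re) :
    ∃ H : κ → Matrix n n ℂ, (∀ k, (H k).PosSemidef) ∧ ∑ k, H k = 1 ∧
      ∀ i, X i = ∑ k, a k i • H k := by
  classical
  have : LocallyConvexSpace ℝ (Matrix n n ℂ) :=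
    inferInstanceAs (LocallyConvexSpace ℝ (n → n → ℂ))
  let c : ℝ := Fintype.card n
  have hc : 0 < c := by simp [c, Fintype.card_pos]
  let L : (κ → Matrix n n ℂ) →ₗ[ℝ] Matrix n n ℂ × (ι → Matrix n n ℂ) :=
    { toFun := fun H ↦ (∑ k, H k, fun i ↦ ∑ k, a k i • H k)
      map_add' := fun H K ↦ by
        ext1
        · simp [Finset.sum_add_distrib]
        · ext1 i
          simp [Finset.sum_add_distrib]
      map_smul' := fun t H ↦ by
        ext1
        · simp [Finset.smul_sum]
        · ext1 i
          simp [Finset.smul_sum, smul_comm t] }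
  have hL : Continuous L := by
    change Continuous fun H : κ → Matrix n n ℂ ↦
      ((∑ k, H k, fun i ↦ ∑ k, a k i • H k) : Matrix n n ℂ × (ι → Matrix n n ℂ))
    fun_prop
  by_contra hcon
  have hmem : (1, X) ∉ L '' posSemidefTuples κ n c := by
    rintro ⟨H, ⟨hH, -⟩, hHX⟩
    exact hcon ⟨H, hH, congrArg Prod.fst hHX, fun i ↦ (congrFun (congrArg Prod.snd hHX) i).symm⟩
  obtain ⟨f, u, hfX, hfS⟩ := geometric_hahn_banach_point_closed
    ((convex_posSemidefTuples c).linear_image L)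
    ((isCompact_posSemidefTuples c).image hL).isClosed hmem
  obtain ⟨B₀, hB₀, hfB₀⟩ := exists_isHermitian_re_trace_mul
    (f.toLinearMap.comp (LinearMap.inl ℝ (Matrix n n ℂ) (ι → Matrix n n ℂ)))
  choose A hA hfA using fun i ↦ exists_isHermitian_re_trace_mul
    (f.toLinearMap.comp ((LinearMap.inr ℝ (Matrix n n ℂ) (ι → Matrix n n ℂ)).comp
      (LinearMap.single ℝ (fun _ : ι ↦ Matrix n n ℂ) i)))
  have hf (Y : Matrix n n ℂ) (Z : ι → Matrix n n ℂ) (hY : Y.IsHermitian)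
      (hZ : ∀ i, (Z i).IsHermitian) :
      f (Y, Z) = (B₀ * Y).trace.re + ∑ i, (A i * Z i).trace.re := by
    rw [← hfB₀ Y hY, ← Finset.sum_congr rfl fun i _ ↦ hfA i (Z i) (hZ i)]
    simp only [LinearMap.comp_apply, ← map_sum, ← map_add]
    simp [-map_add, LinearMap.single_apply, Finset.univ_sum_single]
  have hB : (B₀ - (u / c) • (1 : Matrix n n ℂ)).IsHermitian :=
    hB₀.sub (isHermitian_one.real_smul _)
  have key := h (B₀ - (u / c) • 1) A hB hA fun k ↦ by
    refine PosDef.of_dotProduct_mulVec_pos (hB.add (isHermitian_real_combination hA _))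
      fun v hv ↦ ?_
    have hherm := (hB.add (isHermitian_real_combination hA (a k)))
    rw [Complex.lt_def]
    refine ⟨?_, (hherm.im_star_dotProduct_mulVec_self v).symm⟩
    rw [← trace_mul_vecMulVec_star, Complex.zero_re]
    set V := vecMulVec v (star v) with hV
    have hVp : V.PosSemidef := posSemidef_vecMulVec_self_star v
    have hτ : 0 < V.trace.re := by
      rw [hV, trace_vecMulVec, dotProduct_comm]
      exact (Complex.lt_def.1 (dotProduct_star_self_pos_iff.2 hv)).1
    set t := c / V.trace.re with ht
    have ht0 : 0 < t := div_pos hc hτ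
    have hLV : L (Pi.single k (t • V)) = (t • V, fun i ↦ a k i • t • V) := by
      simp [L, Pi.single_apply]
    have hlt : u < f (L (Pi.single k (t • V))) := by
      refine hfS _ ⟨_, ⟨fun j ↦ ?_, ?_⟩, rfl⟩
      · rcases eq_or_ne j k with rfl | hjk
        · simpa using hVp.real_smul ht0.le
        · simpa [hjk] using PosSemidef.zero
      · rw [Finset.sum_eq_single k (fun j _ hjk ↦ by simp [hjk]) (by simp)]
        simp [ht, hτ.ne']
    rw [hLV, hf _ _ (hVp.1.real_smul t) fun i ↦ (hVp.1.real_smul t).real_smul _] at hlt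
    simp only [Matrix.mul_smul, trace_smul, Complex.smul_re, smul_eq_mul] at hlt
    simp only [Matrix.add_mul, Matrix.sub_mul, Matrix.sum_mul, smul_mul, trace_add, trace_sub,
      trace_sum, trace_smul, Complex.add_re, Complex.sub_re, Complex.re_sum, Complex.smul_re,
      smul_eq_mul, Matrix.one_mul]
    have hlt' : u < t * ((B₀ * V).trace.re + ∑ i, a k i * (A i * V).trace.re) := by
      rw [mul_add, Finset.mul_sum]
      simpa only [mul_left_comm t] using hlt
    have hu : u / c * V.trace.re = u / t := by
      rw [ht]
      field_simp
    have := (div_lt_iff₀' ht0).2 hlt'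
    linarith
  rw [hf 1 X isHermitian_one hX] at hfX
  rw [trace_sub, trace_smul, trace_one, Complex.sub_re, Complex.smul_re] at key
  simp at hfX key
  have : u / c * c = u := by field_simp
  simp only [c] at this
  linarith


lemma re_trace_add_sum_mul [Fintype n] [Fintype ι] (B V : Matrix n n ℂ) (A : ι → Matrix n n ℂ)
    (c : ι → ℝ) : ((B + ∑ i, c i • A i) * V).trace.re =
      (B * V).trace.re + ∑ i, c i * (A i * V).trace.re := by
  simp [Matrix.add_mul, Matrix.sum_mul, trace_sum]

lemma re_trace_sub_sum_mul [Fintype n] [Fintype ι] (B V : Matrix n n ℂ) (A : ι → Matrix n n ℂ)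
    (c : ι → ℝ) : ((B - ∑ i, c i • A i) * V).trace.re =
      (B * V).trace.re - ∑ i, c i * (A i * V).trace.re := by
  simp [Matrix.sub_mul, Matrix.sum_mul, trace_sum]

/-- A pencil that is positive semidefinite at all sign vectors is so on the whole cube. -/
lemma posSemidef_sub_sum_of_abs_le_one [Fintype n] [DecidableEq n] [Fintype ι]
    {B : Matrix n n ℂ} {A : ι → Matrix n n ℂ} (hB : B.IsHermitian) (hA : ∀ i, (A i).IsHermitian)
    (h : ∀ ε : ι → Bool, (B - ∑ i, (if ε i then (1 : ℝ) else -1) • A i).PosSemidef)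
    {z : ι → ℝ} (hz : ∀ i, |z i| ≤ 1) : (B - ∑ i, z i • A i).PosSemidef := by
  have hherm := hB.sub (isHermitian_real_combination hA z)
  refine .of_dotProduct_mulVec_nonneg hherm fun v ↦ ?_
  rw [Complex.le_def]
  refine ⟨?_, (hherm.im_star_dotProduct_mulVec_self v).symm⟩
  rw [← trace_mul_vecMulVec_star, Complex.zero_re, re_trace_sub_sum_mul]
  set V := vecMulVec v (star v) with hV
  have hε := (h fun i ↦ decide (0 ≤ (A i * V).trace.re)).re_trace_mul_nonneg
    (posSemidef_vecMulVec_self_star v)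
  rw [← hV, re_trace_sub_sum_mul] at hε
  refine hε.trans (sub_le_sub_left (Finset.sum_le_sum fun i _ ↦ ?_) _)
  have hzi := abs_le.1 (hz i)
  by_cases hx : 0 ≤ (A i * V).trace.re
  · simp only [hx, decide_true, if_true]
    nlinarith
  · simp only [hx, decide_false, Bool.false_eq_true, if_false]
    nlinarith

/-- The trace inequality dual to both the cube and the diamond inclusion with scaling `s`. -/
def TraceBound [Fintype ι] (n : Type*) [Fintype n] [DecidableEq n] (s : ι → ℝ) : Prop :=
  ∀ (B : Matrix n n ℂ) (A C : ι → Matrix n n ℂ), B.PosDef → (∀ i, (A i).IsHermitian) →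
    (∀ i, (C i).IsHermitian) →
    (∀ ε : ι → Bool, (B - ∑ i, (if ε i then (1 : ℝ) else -1) • A i).PosSemidef) →
    (∀ i, (1 + C i).PosSemidef) → (∀ i, (1 - C i).PosSemidef) →
    ∑ i, s i * (C i * A i).trace.re ≤ B.trace.re

lemma traceBound_of_cube [Fintype n] [DecidableEq n] [Fintype ι] {s : ι → ℝ}
    (h : ∀ X : ι → Matrix n n ℂ, (∀ i, (X i).IsHermitian) →
      (∀ i, (1 + X i).PosSemidef) → (∀ i, (1 - X i).PosSemidef) →
      ∃ (m : ℕ) (z : Fin m → ι → ℝ) (H : Fin m → Matrix n n ℂ),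
        (∀ j i, |z j i| ≤ 1) ∧ (∀ j, (H j).PosSemidef) ∧ (∑ j, H j = 1) ∧
        ∀ i, s i • X i = ∑ j, z j i • H j) : TraceBound n s := by
  intro B A C hB hA hC hBA hC₁ hC₂
  obtain ⟨m, z, H, hz, hH, hH1, hX⟩ := h C hC hC₁ hC₂
  calc ∑ i, s i * (C i * A i).trace.re = ∑ i, ∑ j, z j i * (A i * H j).trace.re := by
        refine Finset.sum_congr rfl fun i _ ↦ ?_
        have : s i * (C i * A i).trace.re = ((s i • C i) * A i).trace.re := by simp
        rw [this, hX, Matrix.sum_mul, trace_sum, Complex.re_sum]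
        refine Finset.sum_congr rfl fun j _ ↦ ?_
        rw [trace_mul_comm (A i)]
        simp
    _ = ∑ j, ∑ i, z j i * (A i * H j).trace.re := Finset.sum_comm
    _ ≤ ∑ j, (B * H j).trace.re := Finset.sum_le_sum fun j _ ↦ by
        have := (posSemidef_sub_sum_of_abs_le_one hB.1 hA hBA (hz j)).re_trace_mul_nonneg (hH j)
        rw [re_trace_sub_sum_mul] at this
        linarith
    _ = B.trace.re := by
        rw [← Complex.re_sum, ← trace_sum, ← Matrix.mul_sum, hH1, Matrix.mul_one]

lemma traceBound_of_diamond [Fintype n] [DecidableEq n] [Fintype ι] {s : ι → ℝ}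
    (h : ∀ X : ι → Matrix n n ℂ, (∀ i, (X i).IsHermitian) →
      (∀ ε : ι → Bool, (1 - ∑ i, (if ε i then (1 : ℝ) else -1) • X i).PosSemidef) →
      ∃ P N : ι → Matrix n n ℂ, (∀ i, (P i).PosSemidef) ∧ (∀ i, (N i).PosSemidef) ∧
        (∀ i, s i • X i = P i - N i) ∧ (1 - ∑ i, (P i + N i)).PosSemidef) :
    TraceBound n s := by
  intro B A C hB hA hC hBA hC₁ hC₂
  obtain ⟨R, hR, rfl⟩ := hB.exists_isUnit_eq_conjTranspose_mul_self
  obtain ⟨S, hRS, hSR⟩ := isUnit_iff_exists.1 hR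
  have hS : Rᴴ * Sᴴ = 1 := by rw [← conjTranspose_mul, hSR, conjTranspose_one]
  have hS' : Sᴴ * Rᴴ = 1 := by rw [← conjTranspose_mul, hRS, conjTranspose_one]
  obtain ⟨P, N, hP, hN, hX, hPN⟩ := h (fun i ↦ Sᴴ * A i * S)
    (fun i ↦ isHermitian_conjTranspose_mul_mul S (hA i)) fun ε ↦ by
      convert (hBA ε).conjTranspose_mul_mul_same S using 1
      rw [Matrix.mul_sub, Matrix.sub_mul, ← Matrix.mul_assoc, hS', Matrix.one_mul, hRS]
      simp [Matrix.mul_sum, Matrix.sum_mul]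
  have hle (i : ι) : s i * (C i * A i).trace.re ≤ (R * Rᴴ * (P i + N i)).trace.re := by
    have heq : s i * (C i * A i).trace.re = (R * C i * Rᴴ * (P i - N i)).trace.re := by
      have hAi : R * C i * Rᴴ * (Sᴴ * A i * S) = R * (C i * A i * S) := by
        simp only [Matrix.mul_assoc]
        rw [← Matrix.mul_assoc Rᴴ, hS, Matrix.one_mul]
      rw [← hX, Matrix.mul_smul, hAi, trace_smul, trace_mul_comm R, Matrix.mul_assoc, hSR,
        Matrix.mul_one, Complex.smul_re, smul_eq_mul]
    have h₁ := ((hC₁ i).mul_mul_conjTranspose_same R).re_trace_mul_nonneg (hN i)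
    have h₂ := ((hC₂ i).mul_mul_conjTranspose_same R).re_trace_mul_nonneg (hP i)
    rw [heq]
    simp only [Matrix.mul_add, Matrix.mul_sub, Matrix.add_mul, Matrix.sub_mul, Matrix.mul_one,
      trace_add, trace_sub, Complex.add_re, Complex.sub_re] at h₁ h₂ ⊢
    linarith
  refine (Finset.sum_le_sum fun i _ ↦ hle i).trans ?_
  have := (posSemidef_self_mul_conjTranspose R).re_trace_mul_nonneg hPN
  rw [Matrix.mul_sub, Matrix.mul_one, Matrix.mul_sum, trace_sub, trace_sum, Complex.sub_re,
    Complex.re_sum] at this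
  rw [trace_mul_comm Rᴴ]
  linarith

lemma TraceBound.cube [Fintype n] [DecidableEq n] [Nonempty n] [Fintype ι] {s : ι → ℝ}
    (hs : TraceBound n s) {X : ι → Matrix n n ℂ} (hX : ∀ i, (X i).IsHermitian)
    (hX₁ : ∀ i, (1 + X i).PosSemidef) (hX₂ : ∀ i, (1 - X i).PosSemidef) :
    ∃ (m : ℕ) (z : Fin m → ι → ℝ) (H : Fin m → Matrix n n ℂ),
      (∀ j i, |z j i| ≤ 1) ∧ (∀ j, (H j).PosSemidef) ∧ (∑ j, H j = 1) ∧
      ∀ i, s i • X i = ∑ j, z j i • H j := by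
  classical
  obtain ⟨H, hH, hH1, hHX⟩ := exists_posSemidef_combination
    (fun (ε : ι → Bool) i ↦ if ε i then (1 : ℝ) else -1) (fun i ↦ s i • X i)
    (fun i ↦ (hX i).real_smul _) fun B A hB hA hBA ↦ by
      have hBA' (ε : ι → Bool) : (B - ∑ i, (if ε i then (1 : ℝ) else -1) • A i).PosDef := by
        convert hBA (fun i ↦ !ε i) using 1
        rw [sub_eq_add_neg, ← Finset.sum_neg_distrib]
        congr 1
        refine Finset.sum_congr rfl fun i _ ↦ ?_
        cases ε i <;> simp
      have hBpos : B.PosDef := by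
        have := ((hBA fun _ ↦ true).add (hBA' fun _ ↦ true)).smul (a := (1 / 2 : ℝ)) (by norm_num)
        convert this using 1
        simp only [if_true, one_smul]
        module
      have := hs B A (fun i ↦ -X i) hBpos hA (fun i ↦ (hX i).neg)
        (fun ε ↦ (hBA' ε).posSemidef) (fun i ↦ by simpa [sub_eq_add_neg] using hX₂ i)
        (fun i ↦ by simpa using hX₁ i)
      simp only [Matrix.neg_mul, trace_neg, Complex.neg_re, mul_neg,
        Finset.sum_neg_distrib, trace_mul_comm (X _)] at this
      simp only [Matrix.mul_smul, trace_smul, Complex.smul_re, smul_eq_mul]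
      linarith
  let e := (Fintype.equivFin (ι → Bool)).symm
  refine ⟨Fintype.card (ι → Bool), fun j i ↦ if e j i then 1 else -1, fun j ↦ H (e j),
    fun j i ↦ ?_, fun j ↦ hH _, ?_, fun i ↦ ?_⟩
  · dsimp only
    split_ifs <;> simp
  · rw [e.sum_comp H, hH1]
  · rw [hHX, e.sum_comp fun ε ↦ (if ε i then (1 : ℝ) else -1) • H ε]

lemma TraceBound.diamond [Fintype n] [DecidableEq n] [Nonempty n] [Fintype ι] {s : ι → ℝ}
    (hs : TraceBound n s) {X : ι → Matrix n n ℂ} (hX : ∀ i, (X i).IsHermitian)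
    (hX₁ : ∀ ε : ι → Bool, (1 - ∑ i, (if ε i then (1 : ℝ) else -1) • X i).PosSemidef) :
    ∃ P N : ι → Matrix n n ℂ, (∀ i, (P i).PosSemidef) ∧ (∀ i, (N i).PosSemidef) ∧
      (∀ i, s i • X i = P i - N i) ∧ (1 - ∑ i, (P i + N i)).PosSemidef := by
  classical
  obtain ⟨H, hH, hH1, hHX⟩ := exists_posSemidef_combination
    (fun (k : Option (ι ⊕ ι)) i ↦ k.elim 0 (Sum.elim (Pi.single i 1) (Pi.single i (-1))))
    (fun i ↦ s i • X i) (fun i ↦ (hX i).real_smul _) fun B A hB hA hBA ↦ by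
      have hBpos : B.PosDef := by simpa using hBA none
      have hadd (i : ι) : (B + A i).PosDef := by
        simpa [Pi.single_apply, ite_smul] using hBA (some (.inl i))
      have hsub (i : ι) : (B - A i).PosDef := by
        simpa [Pi.single_apply, ite_smul, ← sub_eq_add_neg] using hBA (some (.inr i))
      obtain ⟨R, hR, rfl⟩ := hBpos.exists_isUnit_eq_conjTranspose_mul_self
      obtain ⟨S, hRS, hSR⟩ := isUnit_iff_exists.1 hR
      have hS : Rᴴ * Sᴴ = 1 := by rw [← conjTranspose_mul, hSR, conjTranspose_one]
      have hS' : Sᴴ * Rᴴ = 1 := by rw [← conjTranspose_mul, hRS, conjTranspose_one]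
      have hone : Sᴴ * (Rᴴ * R) * S = 1 := by
        rw [← Matrix.mul_assoc, hS', Matrix.one_mul, hRS]
      have hpos : (R * Rᴴ).PosDef :=
        (posSemidef_self_mul_conjTranspose R).posDef_iff_isUnit.2 (hR.mul hR.star)
      have := hs (R * Rᴴ) (fun i ↦ R * X i * Rᴴ) (fun i ↦ -(Sᴴ * A i * S)) hpos
        (fun i ↦ isHermitian_mul_mul_conjTranspose R (hX i))
        (fun i ↦ (isHermitian_conjTranspose_mul_mul S (hA i)).neg)
        (fun ε ↦ by
          convert (hX₁ ε).mul_mul_conjTranspose_same R using 1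
          simp [Matrix.mul_sub, Matrix.sub_mul, Matrix.mul_sum, Matrix.sum_mul])
        (fun i ↦ by
          convert (hsub i).posSemidef.conjTranspose_mul_mul_same S using 1
          rw [Matrix.mul_sub, Matrix.sub_mul, hone, sub_eq_add_neg])
        (fun i ↦ by
          convert (hadd i).posSemidef.conjTranspose_mul_mul_same S using 1
          rw [Matrix.mul_add, Matrix.add_mul, hone, sub_neg_eq_add])
      have htr (i : ι) : (Sᴴ * A i * S * (R * X i * Rᴴ)).trace = (A i * X i).trace := by
        have h₁ : Sᴴ * A i * S * (R * X i * Rᴴ) = Sᴴ * (A i * X i * Rᴴ) := by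
          simp only [Matrix.mul_assoc]
          rw [← Matrix.mul_assoc S, hSR, Matrix.one_mul]
        rw [h₁, trace_mul_comm, Matrix.mul_assoc, hS, Matrix.mul_one]
      simp only [Matrix.neg_mul, trace_neg, Complex.neg_re, mul_neg, Finset.sum_neg_distrib,
        htr, trace_mul_comm R] at this
      simp only [Matrix.mul_smul, trace_smul, Complex.smul_re, smul_eq_mul]
      linarith
  refine ⟨fun i ↦ H (some (.inl i)), fun i ↦ H (some (.inr i)), fun i ↦ hH _, fun i ↦ hH _,
    fun i ↦ ?_, ?_⟩
  · rw [hHX]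
    simp [Fintype.sum_option, Pi.single_apply, sub_eq_add_neg]
  · rw [← hH1, Fintype.sum_option, Fintype.sum_sum_type, Finset.sum_add_distrib,
      add_sub_cancel_right]
    exact hH none

end Matrix

/-- the matrix cube inclusion set `Δ_□(g,d)` equals the matrix diamond inclusion
set `Δ_◇(g,d)`. -/
theorem cube_inclusion_eq_diamond_inclusion (g d : ℕ) (hg : 0 < g) (hd : 0 < d)
    (s : Fin g → ℝ) (hs : ∀ i, s i ∈ Set.Icc (0 : ℝ) 1) :
    (∀ X : Fin g → Matrix (Fin d) (Fin d) ℂ, (∀ i, (X i).IsHermitian) →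
        (∀ i, ((1 : Matrix (Fin d) (Fin d) ℂ) + X i).PosSemidef) →
        (∀ i, ((1 : Matrix (Fin d) (Fin d) ℂ) - X i).PosSemidef) →
        ∃ (n : ℕ) (z : Fin n → Fin g → ℝ) (H : Fin n → Matrix (Fin d) (Fin d) ℂ),
          (∀ j i, |z j i| ≤ 1) ∧ (∀ j, (H j).PosSemidef) ∧ (∑ j, H j = 1) ∧
          ∀ i, s i • X i = ∑ j, z j i • H j) ↔
      (∀ X : Fin g → Matrix (Fin d) (Fin d) ℂ, (∀ i, (X i).IsHermitian) →
        (∀ ε : Fin g → Bool,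
          ((1 : Matrix (Fin d) (Fin d) ℂ) -
            ∑ i, (if ε i then (1 : ℝ) else -1) • X i).PosSemidef) →
        ∃ P N : Fin g → Matrix (Fin d) (Fin d) ℂ,
          (∀ i, (P i).PosSemidef) ∧ (∀ i, (N i).PosSemidef) ∧
          (∀ i, s i • X i = P i - N i) ∧
          ((1 : Matrix (Fin d) (Fin d) ℂ) - ∑ i, (P i + N i)).PosSemidef) := by
  have : Nonempty (Fin d) := ⟨⟨0, hd⟩⟩
  exact ⟨fun h _ hX hX₁ ↦ (traceBound_of_cube h).diamond hX hX₁,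
    fun h _ hX hX₁ hX₂ ↦ (traceBound_of_diamond h).cube hX hX₁ hX₂⟩
end
end
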